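/- arXiv:2212.02079 — 5 statements merged into one kernel-verified Lean document; each statement's English description precedes it below -/
import Mathlib

section
/- Let G be a finite 3-connected simple graph, let k ≥ 5 be a natural number, and suppose that |V(G)| ≥ k + 3 and the minimum degree δ(G) ≥ ⌊(2k + 1)/3⌋ + 2. Then there exists a k-contractible set in G, i.e. a set W ⊆ V(G) with |W| = k such that the induced subgraph G[W] is connected and G − W is 2-connected. -/
open SimpleGraph

/-- A graph is `n`-connected if it has more than `n` vertices and remains connected
after deletion of any set of fewer than `n` vertices. -/
def NConnected {V : Type*} (G : SimpleGraph V) (n : ℕ) : Prop :=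
  n < Nat.card V ∧ ∀ S : Set V, S.ncard < n → (G.induce (Sᶜ : Set V)).Connected

/-- `W` is a contractible set of `G` if `G[W]` is connected and `G − W` is `2`-connected. -/
def ContractibleSet {V : Type*} (G : SimpleGraph V) (W : Set V) : Prop :=
  (G.induce W).Connected ∧ NConnected (G.induce (Wᶜ : Set V)) 2

/-- `S` induces a connected subgraph of `G`. -/
abbrev ConnectedOn {V : Type*} (G : SimpleGraph V) (S : Set V) : Prop :=
  (G.induce S).Connected

/-- `Y` induces a connected subgraph of `G` without cutvertices. -/
def NonseparableOn {V : Type*} (G : SimpleGraph V) (Y : Set V) : Prop :=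
  ConnectedOn G Y ∧ ∀ v, ConnectedOn G (Y \ {v})

/-- `f 0, …, f (s + 1)` is a path of `G` from `x` to `y` with nonempty interior contained in `K`. -/
structure IsEar {V : Type*} (G : SimpleGraph V) (K : Set V) (x y : V) (s : ℕ) (f : ℕ → V) :
    Prop where
  pos : 1 ≤ s
  zero : f 0 = x
  last : f (s + 1) = y
  inj : ∀ i j, i ≤ s + 1 → j ≤ s + 1 → f i = f j → i = j
  adj : ∀ i, i ≤ s → G.Adj (f i) (f (i + 1))
  mem : ∀ i, 1 ≤ i → i ≤ s → f i ∈ K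

section Connectivity

variable {V : Type*} {G : SimpleGraph V}

lemma ConnectedOn.nonempty {S : Set V} (h : ConnectedOn G S) : S.Nonempty :=
  Set.nonempty_coe_sort.1 (SimpleGraph.Connected.nonempty h)

lemma connectedOn_singleton (v : V) : ConnectedOn G {v} :=
  SimpleGraph.Connected.of_subsingleton (G := G.induce {v})

lemma ConnectedOn.union {S T : Set V} (hS : ConnectedOn G S) (hT : ConnectedOn G T)
    (h : (S ∩ T).Nonempty) : ConnectedOn G (S ∪ T) :=
  SimpleGraph.induce_union_connected hS.preconnected hT.preconnected h

lemma ConnectedOn.union_of_adj {S T : Set V} (hS : ConnectedOn G S) (hT : ConnectedOn G T)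
    {a b : V} (ha : a ∈ S) (hb : b ∈ T) (h : G.Adj a b) : ConnectedOn G (S ∪ T) :=
  SimpleGraph.connected_induce_union hS.preconnected hT.preconnected ha hb h

lemma ConnectedOn.insert_of_adj {S : Set V} (hS : ConnectedOn G S) {a b : V} (ha : a ∈ S)
    (h : G.Adj a b) : ConnectedOn G (insert b S) := by
  have := hS.union_of_adj (connectedOn_singleton b) ha rfl h
  rwa [Set.union_singleton] at this

lemma connectedOn_of_hub {Y : Set V} {q : V} (hq : q ∈ Y)
    (h : ∀ v ∈ Y, ∃ S ⊆ Y, ConnectedOn G S ∧ v ∈ S ∧ q ∈ S) : ConnectedOn G Y := by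
  refine SimpleGraph.induce_connected_of_patches q hq fun {v} hv => ?_
  obtain ⟨S, hSY, hS, hvS, hqS⟩ := h v hv
  exact ⟨S, hSY, hqS, hvS, hS.preconnected _ _⟩

lemma ConnectedOn.exists_adj_boundary {Y K : Set V} (hY : ConnectedOn G Y) {a b : V}
    (ha : a ∈ Y) (haK : a ∈ K) (hb : b ∈ Y) (hbK : b ∉ K) :
    ∃ u ∈ K, ∃ z ∈ Y, z ∉ K ∧ G.Adj u z := by
  obtain ⟨p⟩ := hY.preconnected ⟨a, ha⟩ ⟨b, hb⟩
  obtain ⟨d, -, hd1, hd2⟩ := p.exists_boundary_dart {v | v.1 ∈ K} haK hbK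
  exact ⟨d.fst, hd1, d.snd, d.snd.2, hd2, d.adj⟩

lemma exists_component [Finite V] (X : Set V) {u : V} (hu : u ∈ X) :
    ∃ K ⊆ X, u ∈ K ∧ ConnectedOn G K ∧ ∀ v ∈ K, ∀ z ∈ X, G.Adj v z → z ∈ K := by
  obtain ⟨K, hK⟩ := (Set.toFinite {K : Set V | K ⊆ X ∧ u ∈ K ∧ ConnectedOn G K}).exists_maximal
    ⟨{u}, by simpa using hu, rfl, connectedOn_singleton u⟩
  obtain ⟨hKX, huK, hKc⟩ := hK.prop
  refine ⟨K, hKX, huK, hKc, fun v hv z hz hvz => ?_⟩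
  exact hK.le_of_ge ⟨Set.insert_subset hz hKX, Set.mem_insert_of_mem _ huK, hKc.insert_of_adj hv hvz⟩
    (Set.subset_insert z K) (Set.mem_insert z K)

lemma connectedOn_image_Icc {f : ℕ → V} {i j : ℕ} (hij : i ≤ j)
    (h : ∀ l, i ≤ l → l < j → G.Adj (f l) (f (l + 1))) : ConnectedOn G (f '' Set.Icc i j) := by
  induction j, hij using Nat.le_induction with
  | base => simpa using connectedOn_singleton (f i)
  | succ j hij ih =>
    have hs : f '' Set.Icc i (j + 1) = insert (f (j + 1)) (f '' Set.Icc i j) := by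
      rw [← Set.image_insert_eq]
      congr 1
      ext l
      simp only [Set.mem_Icc, Set.mem_insert_iff]
      omega
    rw [hs]
    exact (ih fun l h1 h2 => h l h1 (by omega)).insert_of_adj (Set.mem_image_of_mem f ⟨hij, le_rfl⟩)
      (h j hij (by omega))

lemma IsEar.connectedOn {K : Set V} {x y : V} {s : ℕ} {f : ℕ → V} (hf : IsEar G K x y s f)
    {i j : ℕ} (hij : i ≤ j) (hj : j ≤ s + 1) : ConnectedOn G (f '' Set.Icc i j) :=
  connectedOn_image_Icc hij fun l _ _ => hf.adj l (by omega)

lemma IsEar.image_subset {K : Set V} {x y : V} {s : ℕ} {f : ℕ → V} (hf : IsEar G K x y s f)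
    {i j : ℕ} (hi : 1 ≤ i) (hj : j ≤ s) : f '' Set.Icc i j ⊆ K := by
  rintro _ ⟨l, ⟨h1, h2⟩, rfl⟩
  exact hf.mem l (by omega) (by omega)

lemma IsEar.ncard_image {K : Set V} {x y : V} {s : ℕ} {f : ℕ → V} (hf : IsEar G K x y s f)
    {i j : ℕ} (hj : j ≤ s) : (f '' Set.Icc i j).ncard = j + 1 - i := by
  rw [Set.InjOn.ncard_image, ← Finset.coe_Icc, Set.ncard_coe_finset, Nat.card_Icc]
  intro a ha b hb hab
  exact hf.inj a b (by have := ha.2; omega) (by have := hb.2; omega) hab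

lemma IsEar.mono {K L : Set V} {x y : V} {s : ℕ} {f : ℕ → V} (hf : IsEar G K x y s f)
    (h : K ⊆ L) : IsEar G L x y s f :=
  ⟨hf.pos, hf.zero, hf.last, hf.inj, hf.adj, fun i h1 h2 => h (hf.mem i h1 h2)⟩

lemma ConnectedOn.exists_isEar {K : Set V} (hK : ConnectedOn G K) {x y a b : V} (hxy : x ≠ y)
    (hx : x ∉ K) (hy : y ∉ K) (ha : a ∈ K) (hb : b ∈ K) (hxa : G.Adj x a) (hby : G.Adj b y) :
    ∃ s f, IsEar G K x y s f := by
  obtain ⟨p, hp⟩ := hK.preconnected.exists_isPath ⟨a, ha⟩ ⟨b, hb⟩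
  have hne (i : ℕ) : (p.getVert i).1 ≠ x ∧ (p.getVert i).1 ≠ y :=
    ⟨fun h => hx (h ▸ (p.getVert i).2), fun h => hy (h ▸ (p.getVert i).2)⟩
  refine ⟨p.length + 1, fun i => if i = 0 then x else if i ≤ p.length + 1 then
    (p.getVert (i - 1)).1 else y, by omega, by simp, by simp, ?_, ?_, ?_⟩
  · intro i j hi hj hij
    have key : ∀ i j, i ≤ p.length → j ≤ p.length → (p.getVert i).1 = (p.getVert j).1 → i = j :=
      fun i j hi hj h => hp.getVert_injOn hi hj (Subtype.ext h)
    split_ifs at hij with h1 h2 h3 h4 h5 h6 h7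
    all_goals first
      | omega
      | exact absurd hij (hne _).1
      | exact absurd hij (hne _).2
      | exact absurd hij.symm (hne _).1
      | exact absurd hij.symm (hne _).2
      | exact absurd hij hxy
      | exact absurd hij.symm hxy
      | (have := key _ _ (by omega) (by omega) hij; omega)
  · intro i hi
    rcases Nat.eq_zero_or_pos i with rfl | h0
    · simpa using hxa
    · rcases Nat.lt_or_ge i (p.length + 1) with h | h
      · have := p.adj_getVert_succ (i := i - 1) (by omega)
        rw [Nat.sub_add_cancel h0] at this
        simpa [h0.ne', show i ≤ p.length + 1 by omega, show i ≤ p.length by omega] using this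
      · obtain rfl : i = p.length + 1 := by omega
        simpa using hby
  · intro i h1 h2
    have h0 : i ≠ 0 := by omega
    simp only [h0, h2, if_false, if_true]
    exact (p.getVert (i - 1)).2

lemma NonseparableOn.exists_ne {B : Set V} (hB : NonseparableOn G B) (v : V) :
    ∃ b ∈ B, b ≠ v :=
  (hB.2 v).nonempty

lemma NonseparableOn.extend {B Y : Set V} (hB : NonseparableOn G B) (hBY : B ⊆ Y)
    (h : ∀ u ∈ Y, u ∉ B → ∀ v, v ≠ u → ∃ S ⊆ Y, ConnectedOn G S ∧ u ∈ S ∧ v ∉ S ∧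
      (S ∩ B).Nonempty) : NonseparableOn G Y := by
  have key (v : V) : ConnectedOn G (Y \ {v}) := by
    obtain ⟨q, hqB, hqv⟩ := hB.exists_ne v
    refine connectedOn_of_hub (q := q) ⟨hBY hqB, hqv⟩ fun u hu => ?_
    by_cases huB : u ∈ B
    · exact ⟨B \ {v}, Set.sdiff_subset_sdiff_left hBY, hB.2 v, ⟨huB, hu.2⟩, hqB, hqv⟩
    · obtain ⟨S, hSY, hS, huS, hvS, b, hbS, hbB⟩ := h u hu.1 huB v (Ne.symm hu.2)
      refine ⟨S ∪ B \ {v}, ?_, hS.union (hB.2 v) ⟨b, hbS, hbB, ?_⟩, Or.inl huS, Or.inr ⟨hqB, hqv⟩⟩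
      · rintro z (hz | hz)
        · exact ⟨hSY hz, fun h => hvS (h ▸ hz)⟩
        · exact ⟨hBY hz.1, hz.2⟩
      · exact fun h => hvS (h ▸ hbS)
  refine ⟨?_, key⟩
  obtain ⟨q, hq⟩ := hB.1.nonempty
  refine connectedOn_of_hub (hBY hq) fun u hu => ?_
  by_cases huB : u ∈ B
  · exact ⟨B, hBY, hB.1, huB, hq⟩
  · obtain ⟨v, hvB, -⟩ := hB.exists_ne u
    obtain ⟨w, hwB, hwv⟩ := hB.exists_ne v
    obtain ⟨S, hSY, hS, huS, -, b, hbS, hbB⟩ := h u hu huB v (fun h => huB (h ▸ hvB))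
    exact ⟨S ∪ B, Set.union_subset hSY hBY, hS.union hB.1 ⟨b, hbS, hbB⟩, Or.inl huS, Or.inr hq⟩

lemma NonseparableOn.union_ear {B K : Set V} (hB : NonseparableOn G B) {x y : V} {s : ℕ}
    {f : ℕ → V} (hf : IsEar G K x y s f) (hx : x ∈ B) (hy : y ∈ B) :
    NonseparableOn G (B ∪ f '' Set.Icc 1 s) := by
  refine hB.extend Set.subset_union_left ?_
  rintro u (hu | ⟨i, ⟨hi1, his⟩, rfl⟩) huB v hvu
  · exact absurd hu huB
  have hmem (j : ℕ) (hj : j ≤ s + 1) : f j ∈ B ∪ f '' Set.Icc 1 s := by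
    rcases Nat.eq_zero_or_pos j with rfl | h0
    · exact Or.inl (hf.zero ▸ hx)
    · rcases Nat.lt_or_ge s j with h | h
      · obtain rfl : j = s + 1 := by omega
        exact Or.inl (hf.last ▸ hy)
      · exact Or.inr ⟨j, ⟨h0, h⟩, rfl⟩
  by_cases hv : v ∈ f '' Set.Icc 0 i
  · refine ⟨f '' Set.Icc i (s + 1), ?_, hf.connectedOn (by omega) le_rfl,
      ⟨i, ⟨le_rfl, by omega⟩, rfl⟩, ?_, y, ⟨s + 1, ⟨by omega, le_rfl⟩, hf.last⟩, hy⟩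
    · rintro _ ⟨j, ⟨-, hj⟩, rfl⟩
      exact hmem j hj
    · rintro ⟨b, ⟨hb1, hb2⟩, rfl⟩
      obtain ⟨a, ⟨-, ha⟩, hab⟩ := hv
      have := hf.inj a b (by omega) hb2 hab
      obtain rfl : b = i := by omega
      exact hvu rfl
  · refine ⟨f '' Set.Icc 0 i, ?_, hf.connectedOn (by omega) (by omega),
      ⟨i, ⟨by omega, le_rfl⟩, rfl⟩, hv, x, ⟨0, ⟨le_rfl, by omega⟩, hf.zero⟩, hx⟩
    rintro _ ⟨j, ⟨-, hj⟩, rfl⟩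
    exact hmem j (by omega)

lemma nonseparableOn_pair {a b : V} (h : G.Adj a b) : NonseparableOn G {a, b} := by
  refine ⟨SimpleGraph.induce_pair_connected_of_adj h, fun v => ?_⟩
  by_cases hva : v = a
  · have : ({a, b} : Set V) \ {v} = {b} := by
      ext z
      simp only [Set.mem_sdiff, Set.mem_insert_iff, Set.mem_singleton_iff, hva]
      constructor
      · tauto
      · rintro rfl
        exact ⟨Or.inr rfl, h.ne'⟩
    rw [this]
    exact connectedOn_singleton b
  · by_cases hvb : v = b
    · have : ({a, b} : Set V) \ {v} = {a} := by
        ext z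
        simp only [Set.mem_sdiff, Set.mem_insert_iff, Set.mem_singleton_iff, hvb]
        constructor
        · tauto
        · rintro rfl
          exact ⟨Or.inl rfl, h.ne⟩
      rw [this]
      exact connectedOn_singleton a
    · have : ({a, b} : Set V) \ {v} = {a, b} := by
        ext z
        simp only [Set.mem_sdiff, Set.mem_insert_iff, Set.mem_singleton_iff]
        constructor
        · tauto
        · rintro (rfl | rfl)
          · exact ⟨Or.inl rfl, Ne.symm hva⟩
          · exact ⟨Or.inr rfl, Ne.symm hvb⟩
      rw [this]
      exact SimpleGraph.induce_pair_connected_of_adj h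

/-- A vertex other than `q` whose removal disconnects `X` is a parent, for a suitable parent function,
of some vertex not adjacent to `q`. -/
lemma ConnectedOn.exists_parents {X : Set V} (hX : ConnectedOn G X) {q : V} (hq : q ∈ X) :
    ∃ π : V → V, ∀ w, w ≠ q → w ∉ π '' {t ∈ X | t ≠ q ∧ ¬ G.Adj q t} →
      ConnectedOn G (X \ {w}) := by
  classical
  have hpar : ∀ v : X, v.1 ≠ q → ∃ u : X, G.Adj v u ∧
      (G.induce X).dist ⟨q, hq⟩ u < (G.induce X).dist ⟨q, hq⟩ v := by
    intro v hv
    obtain ⟨p, hp⟩ := hX.exists_walk_length_eq_dist v ⟨q, hq⟩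
    cases p with
    | nil => exact absurd rfl hv
    | cons h p =>
      refine ⟨_, h, ?_⟩
      rw [SimpleGraph.dist_comm, SimpleGraph.dist_comm (v := v), ← hp]
      exact lt_of_le_of_lt (SimpleGraph.dist_le p) (by simp)
  choose! par hadj hlt using hpar
  refine ⟨fun v => if h : v ∈ X then (par ⟨v, h⟩).1 else v, fun w hwq hw => ?_⟩
  refine connectedOn_of_hub (q := q) ⟨hq, Ne.symm hwq⟩ ?_
  have key : ∀ n, ∀ v : X, v.1 ≠ w → (G.induce X).dist ⟨q, hq⟩ v = n →
      ∃ S ⊆ X \ {w}, ConnectedOn G S ∧ v.1 ∈ S ∧ q ∈ S := by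
    intro n
    induction n using Nat.strong_induction_on with
    | _ n ih =>
      intro v hvw hn
      by_cases hvq : v.1 = q
      · exact ⟨{q}, by simpa using ⟨hq, Ne.symm hwq⟩, connectedOn_singleton q, hvq, rfl⟩
      by_cases hqv : G.Adj q v
      · refine ⟨{q, v.1}, ?_, SimpleGraph.induce_pair_connected_of_adj hqv, Or.inr rfl, Or.inl rfl⟩
        rintro z (rfl | rfl)
        exacts [⟨hq, Ne.symm hwq⟩, ⟨v.2, hvw⟩]
      · have hpw : (par v).1 ≠ w := by
          rintro rfl
          exact hw ⟨v, ⟨v.2, hvq, hqv⟩, by simp⟩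
        obtain ⟨S, hSX, hS, hpS, hqS⟩ := ih _ (hn ▸ hlt v hvq) (par v) hpw rfl
        exact ⟨insert v.1 S, Set.insert_subset ⟨v.2, hvw⟩ hSX, hS.insert_of_adj hpS (hadj v hvq).symm,
          Set.mem_insert _ _, Set.mem_insert_of_mem _ hqS⟩
  exact fun v hv => key _ ⟨v, hv.1⟩ hv.2 rfl

end Connectivity

section MaximalNonseparable

variable {V : Type*} {G : SimpleGraph V}

lemma exists_adj_avoiding_pair (h3 : ∀ p q, ConnectedOn G ({p, q}ᶜ)) {K : Set V} {u o : V}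
    (p q : V) (hu : u ∈ K) (ho : o ∉ K) (hup : u ≠ p) (huq : u ≠ q) (hop : o ≠ p) (hoq : o ≠ q) :
    ∃ k ∈ K, ∃ z, z ∉ K ∧ z ≠ p ∧ z ≠ q ∧ G.Adj k z := by
  obtain ⟨k, hk, z, hz, hzK, hkz⟩ := (h3 p q).exists_adj_boundary (K := K) (a := u) (b := o)
    (by simp [hup, huq]) hu (by simp [hop, hoq]) ho
  simp only [Set.mem_compl_iff, Set.mem_insert_iff, Set.mem_singleton_iff, not_or] at hz
  exact ⟨k, hk, z, hzK, hz.1, hz.2, hkz⟩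

/-- `U` is an inclusion-minimal connected proper superset of `W` whose complement is nonseparable
and contains the vertices `a` and `b`. -/
def IsMinimalExtension (G : SimpleGraph V) (W : Set V) (a b : V) (U : Set V) : Prop :=
  Minimal (fun U => W ⊂ U ∧ ConnectedOn G U ∧ NonseparableOn G Uᶜ ∧ a ∉ U ∧ b ∉ U) U

variable {W U : Set V} {a b : V}

lemma IsMinimalExtension.exists_attachment (hU : IsMinimalExtension G W a b U)
    (hW : ConnectedOn G W) : ∃ p ∈ U \ W, ∃ w ∈ W, G.Adj w p := by
  obtain ⟨hWU, hUc, -⟩ := hU.prop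
  obtain ⟨w₀, hw₀⟩ := hW.nonempty
  obtain ⟨c, hcU, hcW⟩ := Set.exists_of_ssubset hWU
  obtain ⟨w, hw, p, hpU, hpW, hwp⟩ := hUc.exists_adj_boundary (hWU.1 hw₀) hw₀ hcU hcW
  exact ⟨p, ⟨hpU, hpW⟩, w, hw, hwp⟩

variable [Finite V]

lemma exists_isMinimalExtension (h3 : ∀ p q, ConnectedOn G ({p, q}ᶜ)) {c : V} (hab : G.Adj a b)
    (ha : a ∉ W) (hb : b ∉ W) (hc : c ∉ W) (hca : c ≠ a) (hcb : c ≠ b) :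
    ∃ U, IsMinimalExtension G W a b U := by
  refine (Set.toFinite
    {U | W ⊂ U ∧ ConnectedOn G U ∧ NonseparableOn G Uᶜ ∧ a ∉ U ∧ b ∉ U}).exists_minimal
    ⟨{a, b}ᶜ, ?_, h3 a b, ?_, by simp, by simp⟩
  · refine (Set.ssubset_iff_of_subset ?_).2 ⟨c, by simp [hca, hcb], hc⟩
    intro w hw
    simp only [Set.mem_compl_iff, Set.mem_insert_iff, Set.mem_singleton_iff, not_or]
    exact ⟨fun h => ha (h ▸ hw), fun h => hb (h ▸ hw)⟩
  · rw [compl_compl]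
    exact nonseparableOn_pair hab

/-- Every ear outside a minimal extension of `W` contains all attachments of `W`. -/
lemma IsMinimalExtension.mem_of_isEar (hU : IsMinimalExtension G W a b U)
    (h3 : ∀ p q, ConnectedOn G ({p, q}ᶜ)) (hW : ConnectedOn G W) {x y : V} {s : ℕ} {f : ℕ → V}
    (hf : IsEar G (U \ W) x y s f) (hx : x ∉ U) (hy : y ∉ U) {p w : V} (hp : p ∈ U \ W)
    (hw : w ∈ W) (hwp : G.Adj w p) : p ∈ f '' Set.Icc 1 s := by
  by_contra hpS
  obtain ⟨hWU, hUc, hUn, haU, hbU⟩ := hU.prop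
  have hSU : f '' Set.Icc 1 s ⊆ U \ W := hf.image_subset le_rfl le_rfl
  have hWX : W ⊆ U \ f '' Set.Icc 1 s := fun z hz => ⟨hWU.1 hz, fun h => (hSU h).2 hz⟩
  obtain ⟨D, hDX, hwD, hDc, hD⟩ := exists_component (G := G) (U \ f '' Set.Icc 1 s) (hWX hw)
  have hWD : W ⊆ D := by
    intro z hz
    by_contra hzD
    obtain ⟨k, hk, z', hz'W, hz'D, hkz'⟩ := hW.exists_adj_boundary hw hwD hz hzD
    exact hz'D (hD k hk z' (hWX hz'W) hkz')
  have hpD : p ∈ D := hD w hwD p ⟨hp.1, hpS⟩ hwp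
  have hDU : D ⊆ U := hDX.trans Set.sdiff_subset
  have hY : NonseparableOn G (Uᶜ ∪ f '' Set.Icc 1 s) := hUn.union_ear hf hx hy
  have hYD : Uᶜ ∪ f '' Set.Icc 1 s ⊆ Dᶜ := by
    rintro z (hz | hz) hzD
    exacts [hz (hDU hzD), (hDX hzD).2 hz]
  have hDn : NonseparableOn G Dᶜ := by
    refine hY.extend hYD fun u huD huY v hvu => ?_
    obtain ⟨K, hKX, huK, hKc, hK⟩ := exists_component (G := G)
      ((Dᶜ \ {v}) \ (Uᶜ ∪ f '' Set.Icc 1 s)) (u := u) ⟨⟨huD, Ne.symm hvu⟩, huY⟩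
    obtain ⟨o, hoU, hov⟩ := hUn.exists_ne v
    obtain ⟨k, hk, z, hzK, hzv, -, hkz⟩ := exists_adj_avoiding_pair h3 (K := K) v v huK
      (fun h => (hKX h).2 (Or.inl hoU)) (Ne.symm hvu) (Ne.symm hvu) hov hov
    have hkX := hKX hk
    have hzD : z ∉ D := by
      intro hz
      refine hkX.1.1 (hD z hz k ⟨?_, fun h => hkX.2 (Or.inr h)⟩ hkz.symm)
      by_contra h
      exact hkX.2 (Or.inl h)
    have hzY : z ∈ Uᶜ ∪ f '' Set.Icc 1 s := by
      by_contra h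
      exact hzK (hK k hk z ⟨⟨hzD, hzv⟩, h⟩ hkz)
    refine ⟨insert z K, Set.insert_subset hzD fun t ht => (hKX ht).1.1,
      hKc.insert_of_adj hk hkz, Or.inr huK, ?_, z, Or.inl rfl, hzY⟩
    rintro (h | h)
    exacts [hzv h.symm, (hKX h).1.2 rfl]
  have hle := hU.le_of_le (y := D) ⟨(Set.ssubset_iff_of_subset hWD).2 ⟨p, hpD, hp.2⟩, hDc, hDn,
    fun h => haU (hDU h), fun h => hbU (hDU h)⟩ hDU
  have h1 : f 1 ∈ f '' Set.Icc 1 s := ⟨1, ⟨le_rfl, hf.pos⟩, rfl⟩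
  exact (hDX (hle (hSU h1).1)).2 h1

lemma IsMinimalExtension.mem_of_connectedOn (hU : IsMinimalExtension G W a b U)
    (h3 : ∀ p q, ConnectedOn G ({p, q}ᶜ)) (hW : ConnectedOn G W) {S : Set V} (hS : S ⊆ U \ W)
    (hSc : ConnectedOn G S) {x y k l : V} (hxy : x ≠ y) (hx : x ∉ U) (hy : y ∉ U) (hk : k ∈ S)
    (hl : l ∈ S) (hxk : G.Adj x k) (hly : G.Adj l y) {p w : V} (hp : p ∈ U \ W)
    (hw : w ∈ W) (hwp : G.Adj w p) : p ∈ S := by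
  obtain ⟨s, f, hf⟩ := hSc.exists_isEar hxy (fun h => hx (hS h).1) (fun h => hy (hS h).1) hk hl
    hxk hly
  exact hf.image_subset le_rfl le_rfl (hU.mem_of_isEar h3 hW (hf.mono hS) hx hy hp hw hwp)

lemma IsMinimalExtension.exists_isEar (hU : IsMinimalExtension G W a b U)
    (hW : ConnectedOn G W) (hWn : NonseparableOn G Wᶜ) :
    ∃ x y s f, x ≠ y ∧ x ∉ U ∧ y ∉ U ∧ IsEar G (U \ W) x y s f := by
  obtain ⟨hWU, hUc, hUn, -⟩ := hU.prop
  obtain ⟨p, hp, -⟩ := hU.exists_attachment hW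
  obtain ⟨K, hKX, hpK, hKc, hK⟩ := exists_component (G := G) (U \ W) hp
  have hatt : ∀ v ∉ U, ∃ k ∈ K, ∃ z, z ∉ U ∧ z ≠ v ∧ G.Adj k z := by
    intro v hv
    obtain ⟨o, hoU, hov⟩ := hUn.exists_ne v
    obtain ⟨k, hk, z, hz, hzK, hkz⟩ := (hWn.2 v).exists_adj_boundary (K := K) (a := p) (b := o)
      ⟨hp.2, fun h => hv (h ▸ hp.1)⟩ hpK ⟨fun h => hoU (hWU.1 h), hov⟩ (fun h => hoU (hKX h).1)
    exact ⟨k, hk, z, fun h => hzK (hK k hk z ⟨h, hz.1⟩ hkz), hz.2, hkz⟩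
  obtain ⟨v, hv⟩ := hUn.1.nonempty
  obtain ⟨k, hk, x, hxU, -, hkx⟩ := hatt v hv
  obtain ⟨l, hl, y, hyU, hyx, hly⟩ := hatt x hxU
  obtain ⟨s, f, hf⟩ := hKc.exists_isEar (Ne.symm hyx) (fun h => hxU (hKX h).1)
    (fun h => hyU (hKX h).1) hk hl hkx.symm hly
  exact ⟨x, y, s, f, Ne.symm hyx, hxU, hyU, hf.mono hKX⟩

/-- Every vertex of a minimal extension of `W` outside `W` is adjacent to `W`. -/
lemma IsMinimalExtension.exists_adj (hU : IsMinimalExtension G W a b U)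
    (h3 : ∀ p q, ConnectedOn G ({p, q}ᶜ)) (hW : ConnectedOn G W) (hWn : NonseparableOn G Wᶜ)
    {u : V} (hu : u ∈ U \ W) : ∃ w ∈ W, G.Adj w u := by
  by_contra hcon
  obtain ⟨hWU, hUc, hUn, -⟩ := hU.prop
  obtain ⟨n, hn, w, hw, hwn⟩ := hU.exists_attachment hW
  obtain ⟨x, y, s, f, hxy, hxU, hyU, hf⟩ := hU.exists_isEar hW hWn
  set N : Set V := {p ∈ U \ W | ∃ w ∈ W, G.Adj w p} with hN
  obtain ⟨K, hKX, huK, hKc, hK⟩ := exists_component (G := G) ((U \ W) \ N) (u := u)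
    ⟨hu, fun h => hcon h.2⟩
  have hKP : K ⊆ U \ W := fun k hk => (hKX hk).1
  -- a neighbour of `K` lies in `N` or outside `U`
  have hnb : ∀ k ∈ K, ∀ z, z ∉ K → G.Adj k z → z ∈ N ∨ z ∉ U := by
    intro k hk z hzK hkz
    by_contra! h
    have hzW : z ∉ W := fun hz => (hKX hk).2 ⟨hKP hk, z, hz, hkz.symm⟩
    exact hzK (hK k hk z ⟨⟨h.2, hzW⟩, h.1⟩ hkz)
  have hnext : ∀ p q, p ∉ K → q ∉ K → p ∉ W → q ∉ W →
      ∃ k ∈ K, ∃ z, z ≠ p ∧ z ≠ q ∧ G.Adj k z ∧ (z ∈ N ∨ z ∉ U) := by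
    intro p q hp hq hpW hqW
    obtain ⟨k, hk, z, hzK, hzp, hzq, hkz⟩ := exists_adj_avoiding_pair h3 (K := K) (o := w) p q huK
      (fun h => (hKP h).2 hw) (fun h => hp (h ▸ huK)) (fun h => hq (h ▸ huK))
      (fun h => hpW (h ▸ hw)) (fun h => hqW (h ▸ hw))
    exact ⟨k, hk, z, hzp, hzq, hkz, hnb k hk z hzK hkz⟩
  have hNK : ∀ z ∈ N, z ∉ K := fun z hz h => (hKX h).2 hz
  have houtside : ∀ z ∉ U, z ∉ K ∧ z ∉ W := fun z hz =>
    ⟨fun h => hz (hKP h).1, fun h => hz (hWU.1 h)⟩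
  have hNS : ∀ S ⊆ U \ W, ConnectedOn G S → ∀ x y k l, x ≠ y → x ∉ U → y ∉ U → k ∈ S → l ∈ S →
      G.Adj x k → G.Adj l y → N ⊆ S := by
    rintro S hS hSc x y k l hxy hx hy hk hl hxk hly z ⟨hz, v, hv, hvz⟩
    exact hU.mem_of_connectedOn h3 hW hS hSc hxy hx hy hk hl hxk hly hz hv hvz
  have hunique : ∀ k ∈ K, ∀ l ∈ K, ∀ z z', z ∉ U → z' ∉ U → G.Adj k z → G.Adj l z' → z = z' := by
    intro k hk l hl z z' hz hz' hkz hlz'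
    by_contra hne
    have hnN : n ∈ N := ⟨hn, w, hw, hwn⟩
    exact hNK n hnN (hNS K hKP hKc z z' k l hne hz hz' hk hl hkz.symm hlz' hnN)
  have hNf : N ⊆ f '' Set.Icc 1 s := fun z hz =>
    hU.mem_of_isEar h3 hW hf hxU hyU hz.1 hz.2.choose_spec.1 hz.2.choose_spec.2
  classical
  set I : Finset ℕ := (Finset.Icc 1 s).filter fun i => f i ∈ N ∧ ∃ k ∈ K, G.Adj k (f i) with hI
  have hmemI : ∀ z ∈ N, ∀ k ∈ K, G.Adj k z → ∃ l ∈ I, f l = z := by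
    intro z hz k hk hkz
    obtain ⟨l, hl, rfl⟩ := hNf hz
    exact ⟨l, Finset.mem_filter.2 ⟨Finset.mem_Icc.2 hl, hz, k, hk, hkz⟩, rfl⟩
  have hIne : I.Nonempty := by
    obtain ⟨k, hk, z, -, -, hkz, hz | hz⟩ := hnext x x (houtside x hxU).1 (houtside x hxU).1
      (houtside x hxU).2 (houtside x hxU).2
    · obtain ⟨l, hl, -⟩ := hmemI z hz k hk hkz
      exact ⟨l, hl⟩
    · obtain ⟨k', hk', z', hz'z, -, hkz', hz' | hz'⟩ := hnext z z (houtside z hz).1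
        (houtside z hz).1 (houtside z hz).2 (houtside z hz).2
      · obtain ⟨l, hl, -⟩ := hmemI z' hz' k' hk' hkz'
        exact ⟨l, hl⟩
      · exact absurd (hunique k' hk' k hk z' z hz' hz hkz' hkz) hz'z
  obtain ⟨i, hiI, himin⟩ : ∃ i ∈ I, ∀ l ∈ I, i ≤ l := ⟨_, I.min'_mem hIne, I.min'_le⟩
  obtain ⟨j, hjI, hjmax⟩ : ∃ j ∈ I, ∀ l ∈ I, l ≤ j := ⟨_, I.max'_mem hIne, I.le_max'⟩
  obtain ⟨hi, hiN, ki, hki, hadji⟩ := Finset.mem_filter.1 hiI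
  obtain ⟨hj, hjN, kj, hkj, hadjj⟩ := Finset.mem_filter.1 hjI
  rw [Finset.mem_Icc] at hi hj
  have hij := himin j hjI
  have hxf : G.Adj x (f 1) := by simpa [hf.zero] using hf.adj 0 (by omega)
  have hfy : G.Adj (f s) y := by simpa [hf.last] using hf.adj s le_rfl
  have hA : f '' Set.Icc 1 i ⊆ U \ W := hf.image_subset le_rfl hi.2
  have hC : f '' Set.Icc j s ⊆ U \ W := hf.image_subset hj.1 le_rfl
  have hAc : ConnectedOn G (f '' Set.Icc 1 i ∪ K) :=
    (hf.connectedOn hi.1 (by omega)).union_of_adj hKc ⟨i, ⟨hi.1, le_rfl⟩, rfl⟩ hki hadji.symm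
  have hCc : ConnectedOn G (K ∪ f '' Set.Icc j s) :=
    hKc.union_of_adj (hf.connectedOn hj.2 (by omega)) hkj ⟨j, ⟨le_rfl, hj.2⟩, rfl⟩ hadjj
  have hf1 : f 1 ∈ f '' Set.Icc 1 i := ⟨1, ⟨le_rfl, hi.1⟩, rfl⟩
  have hfs : f s ∈ f '' Set.Icc j s := ⟨s, ⟨hj.2, le_rfl⟩, rfl⟩
  obtain ⟨k, hk, h, hhi, hhj, hkh, hh | hh⟩ := hnext (f i) (f j) (hNK _ hiN) (hNK _ hjN)
    hiN.1.2 hjN.1.2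
  · obtain ⟨l, hl, rfl⟩ := hmemI h hh k hk hkh
    have := hNS ((f '' Set.Icc 1 i ∪ K) ∪ (K ∪ f '' Set.Icc j s))
      (Set.union_subset (Set.union_subset hA hKP) (Set.union_subset hKP hC))
      (hAc.union hCc ⟨u, Or.inr huK, Or.inl huK⟩) x y (f 1) (f s) hxy hxU hyU
      (Or.inl (Or.inl hf1)) (Or.inr (Or.inr hfs)) hxf hfy hh
    have hls := Finset.mem_Icc.1 (Finset.mem_filter.1 hl).1
    have hil := himin l hl
    have hlj := hjmax l hl
    rcases this with (⟨t, ht, htl⟩ | h') | h' | ⟨t, ht, htl⟩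
    · have := hf.inj t l (by have := ht.2; omega) (by omega) htl
      exact hhi (by rw [show l = i by have := ht.2; omega])
    · exact hNK _ hh h'
    · exact hNK _ hh h'
    · have := hf.inj t l (by have := ht.2; omega) (by omega) htl
      exact hhj (by rw [show l = j by have := ht.1; omega])
  · have hji : j ≤ i := by
      by_cases hhx : h = x
      · have := hNS _ (Set.union_subset hKP hC) hCc h y k (f s) (hhx ▸ hxy) hh hyU (Or.inl hk)
          (Or.inr hfs) hkh.symm hfy hiN
        rcases this with h' | ⟨t, ht, hti⟩
        · exact absurd h' (hNK _ hiN)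
        · have := hf.inj t i (by have := ht.2; omega) (by omega) hti
          exact this ▸ ht.1
      · have := hNS _ (Set.union_subset hA hKP) hAc x h (f 1) k (Ne.symm hhx) hxU hh (Or.inl hf1)
          (Or.inr hk) hxf hkh hjN
        rcases this with ⟨t, ht, htj⟩ | h'
        · have := hf.inj t j (by have := ht.2; omega) (by omega) htj
          exact this ▸ ht.2
        · exact absurd h' (hNK _ hjN)
    obtain ⟨k', hk', z, hzi, hzh, hkz, hz | hz⟩ := hnext (f i) h (hNK _ hiN) (houtside h hh).1
      hiN.1.2 (houtside h hh).2
    · obtain ⟨l, hl, rfl⟩ := hmemI z hz k' hk' hkz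
      exact hzi (by rw [show l = i by have := himin l hl; have := hjmax l hl; omega])
    · exact hzh (hunique k' hk' k hk z h hz hh hkz hkh)

/-- The part of a minimal extension of `W` outside `W` is a path, and if it has at least two
vertices, each of them has degree two outside `W`. -/
lemma IsMinimalExtension.exists_isEar_eq (hU : IsMinimalExtension G W a b U)
    (h3 : ∀ p q, ConnectedOn G ({p, q}ᶜ)) (hW : ConnectedOn G W) (hWn : NonseparableOn G Wᶜ) :
    ∃ x y s f, x ≠ y ∧ x ∉ U ∧ y ∉ U ∧ IsEar G (U \ W) x y s f ∧ U \ W = f '' Set.Icc 1 s ∧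
      (2 ≤ s → ∀ i, 1 ≤ i → i ≤ s → ∀ u ∉ W, G.Adj (f i) u → u = f (i - 1) ∨ u = f (i + 1)) := by
  obtain ⟨x, y, s, f, hxy, hxU, hyU, hf⟩ := hU.exists_isEar hW hWn
  have hsub : ∀ S ⊆ U \ W, ConnectedOn G S → ∀ x y k l, x ≠ y → x ∉ U → y ∉ U → k ∈ S → l ∈ S →
      G.Adj x k → G.Adj l y → U \ W ⊆ S := by
    intro S hS hSc x y k l hxy hx hy hk hl hxk hly z hz
    obtain ⟨v, hv, hvz⟩ := hU.exists_adj h3 hW hWn hz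
    exact hU.mem_of_connectedOn h3 hW hS hSc hxy hx hy hk hl hxk hly hz hv hvz
  have heq : U \ W = f '' Set.Icc 1 s := by
    refine Set.Subset.antisymm (fun z hz => ?_) (hf.image_subset le_rfl le_rfl)
    obtain ⟨v, hv, hvz⟩ := hU.exists_adj h3 hW hWn hz
    exact hU.mem_of_isEar h3 hW hf hxU hyU hz hv hvz
  refine ⟨x, y, s, f, hxy, hxU, hyU, hf, heq, fun hs => ?_⟩
  have hxf : G.Adj x (f 1) := by simpa [hf.zero] using hf.adj 0 (by omega)
  have hfy : G.Adj (f s) y := by simpa [hf.last] using hf.adj s le_rfl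
  have hinit : ∀ i, 1 ≤ i → i < s → ∀ h, h ∉ U → h ≠ x → ¬ G.Adj (f i) h := by
    intro i hi his h hhU hhx hih
    obtain ⟨t, ht, hts⟩ := hsub (f '' Set.Icc 1 i) (hf.image_subset le_rfl (by omega))
      (hf.connectedOn hi (by omega)) x h (f 1) (f i) (Ne.symm hhx) hxU hhU ⟨1, ⟨le_rfl, hi⟩, rfl⟩
      ⟨i, ⟨hi, le_rfl⟩, rfl⟩ hxf hih (hf.mem s (by omega) le_rfl)
    have := hf.inj t s (by have := ht.2; omega) (by omega) hts
    have := ht.2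
    omega
  have hfinal : ∀ i, 1 < i → i ≤ s → ∀ h, h ∉ U → h ≠ y → ¬ G.Adj (f i) h := by
    intro i hi his h hhU hhy hih
    obtain ⟨t, ht, hts⟩ := hsub (f '' Set.Icc i s) (hf.image_subset (by omega) le_rfl)
      (hf.connectedOn his (by omega)) h y (f i) (f s) hhy hhU hyU ⟨i, ⟨le_rfl, his⟩, rfl⟩
      ⟨s, ⟨his, le_rfl⟩, rfl⟩ hih.symm hfy (hf.mem 1 le_rfl (by omega))
    have := hf.inj t 1 (by have := ht.2; omega) (by omega) hts
    have := ht.1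
    omega
  have hchord : ∀ i j, 1 ≤ i → i + 1 < j → j ≤ s → ¬ G.Adj (f i) (f j) := by
    intro i j hi hij hj hadj
    have hc := (hf.connectedOn hi (by omega)).union_of_adj (hf.connectedOn hj (by omega))
      (Set.mem_image_of_mem f (Set.mem_Icc.2 ⟨hi, le_rfl⟩))
      (Set.mem_image_of_mem f (Set.mem_Icc.2 ⟨le_rfl, hj⟩)) hadj
    have := hsub _ (Set.union_subset (hf.image_subset le_rfl (by omega))
      (hf.image_subset (by omega) le_rfl)) hc x y (f 1) (f s) hxy hxU hyU
      (Or.inl ⟨1, ⟨le_rfl, hi⟩, rfl⟩) (Or.inr ⟨s, ⟨hj, le_rfl⟩, rfl⟩) hxf hfy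
      (hf.mem (i + 1) (by omega) (by omega))
    rcases this with ⟨t, ht, hts⟩ | ⟨t, ht, hts⟩ <;>
    · have h1 := ht.1
      have h2 := ht.2
      have := hf.inj t (i + 1) (by omega) (by omega) hts
      omega
  intro i hi his u huW hadj
  by_cases huU : u ∈ U
  · obtain ⟨j, ⟨hj1, hjs⟩, rfl⟩ := heq.subset ⟨huU, huW⟩
    have h1 : ¬ i + 1 < j := fun h => hchord i j hi h hjs hadj
    have h2 : ¬ j + 1 < i := fun h => hchord j i hj1 h his hadj.symm
    have h3 : i ≠ j := fun h => hadj.ne (by rw [h])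
    rcases lt_or_gt_of_ne h3 with h | h
    · exact Or.inr (by rw [show j = i + 1 by omega])
    · exact Or.inl (by rw [show j = i - 1 by omega])
  · by_cases hux : u = x
    · by_cases hi1 : i = 1
      · left
        rw [hux, hi1, ← hf.zero]
      · exact absurd hadj (hfinal i (by omega) his u huU (hux ▸ hxy))
    · by_cases his' : i = s
      · by_cases huy : u = y
        · right
          rw [huy, his', hf.last]
        · exact absurd hadj (hfinal i (by omega) his u huU huy)
      · exact absurd hadj (hinit i hi (by omega) u huU hux)

end MaximalNonseparable

section Exchange

lemma ncard_pair_le {V : Type*} (p q : V) : ({p, q} : Set V).ncard ≤ 2 :=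
  (Set.ncard_insert_le p {q}).trans (by rw [Set.ncard_singleton])

variable {V : Type*} {G : SimpleGraph V} {W : Set V}

/-- Two distinct vertices outside `U` can be joined, through a vertex `w` of `W`, to the tail
of the path `U \ W`. -/
lemma IsEar.exists_nonseparableOn_tail {U : Set V} (hWU : W ⊆ U) (hUn : NonseparableOn G Uᶜ)
    {x y : V} {s c : ℕ} {f : ℕ → V} (hf : IsEar G (U \ W) x y s f) (hy : y ∉ U) (hcs : c ≤ s)
    {P : V → Prop} (hP : ∀ i, 1 ≤ i → i ≤ s → P (f i)) {u₁ u₂ : V} (hu : u₁ ≠ u₂)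
    (hu₁ : u₁ ∉ U) (hu₂ : u₂ ∉ U) (hP₁ : P u₁) (hP₂ : P u₂) :
    ∃ e₁ e₂, P e₁ ∧ P e₂ ∧ ∀ w ∈ W, G.Adj w e₁ → G.Adj w e₂ →
      NonseparableOn G (Uᶜ ∪ insert w (f '' Set.Icc (c + 1) s)) := by
  have hne : ∀ w ∈ W, ∀ z ∉ U, w ≠ z := fun w hw z hz h => hz (h ▸ hWU hw)
  rcases hcs.eq_or_lt with rfl | hlt
  · refine ⟨u₁, u₂, hP₁, hP₂, fun w hw h₁ h₂ => ?_⟩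
    have hg : IsEar G Set.univ u₁ u₂ 1
        (fun i => if i = 0 then u₁ else if i = 1 then w else u₂) := by
      refine ⟨le_rfl, by simp, by simp, ?_, ?_, fun _ _ _ => trivial⟩
      · intro i j hi hj hij
        have a := hne w hw u₁ hu₁
        have b := hne w hw u₂ hu₂
        interval_cases i <;> interval_cases j <;> simp_all
      · intro i hi
        interval_cases i
        · simpa using h₁.symm
        · simpa using h₂
    have := hUn.union_ear hg hu₁ hu₂
    simpa using this
  · obtain ⟨u, huU, huP, huy⟩ : ∃ u, u ∉ U ∧ P u ∧ u ≠ y := by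
      by_cases h : u₁ = y
      · exact ⟨u₂, hu₂, hP₂, fun h' => hu (h.trans h'.symm)⟩
      · exact ⟨u₁, hu₁, hP₁, h⟩
    refine ⟨u, f (c + 1), huP, hP _ (by omega) hlt, fun w hw h₁ h₂ => ?_⟩
    have hfne : ∀ i, 1 ≤ i → i ≤ s + 1 → f i ≠ w ∧ f i ≠ u := by
      intro i hi his
      rcases Nat.lt_or_ge s i with h | h
      · obtain rfl : i = s + 1 := by omega
        rw [hf.last]
        exact ⟨(hne w hw y hy).symm, huy.symm⟩
      · have := hf.mem i hi h
        exact ⟨fun h => this.2 (h ▸ hw), fun h => huU (h ▸ this.1)⟩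
    have hg : IsEar G Set.univ u y (s - c + 1)
        (fun i => if i = 0 then u else if i = 1 then w else f (c + i - 1)) := by
      refine ⟨by omega, by simp, ?_, ?_, ?_, fun _ _ _ => trivial⟩
      · rw [if_neg (by omega), if_neg (by omega), ← hf.last]
        congr 1
        omega
      · intro i j hi hj hij
        have hwu := hne w hw u huU
        split_ifs at hij with h1 h2 h3 h4 h5 h6 h7 h8
        all_goals first
          | omega
          | exact absurd hij hwu
          | exact absurd hij.symm hwu
          | exact absurd hij (hfne _ (by omega) (by omega)).1
          | exact absurd hij.symm (hfne _ (by omega) (by omega)).1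
          | exact absurd hij (hfne _ (by omega) (by omega)).2
          | exact absurd hij.symm (hfne _ (by omega) (by omega)).2
          | (have := hf.inj _ _ (by omega) (by omega) hij; omega)
      · intro i hi
        rcases Nat.lt_or_ge i 2 with h | h
        · interval_cases i
          · simpa using h₁.symm
          · simpa using h₂
        · have := hf.adj (c + i - 1) (by omega)
          rw [Nat.sub_add_cancel (by omega)] at this
          simpa [show i ≠ 0 by omega, show i ≠ 1 by omega] using this
    have hn := hUn.union_ear hg huU hy
    convert hn using 2
    ext z
    simp only [Set.mem_insert_iff, Set.mem_image, Set.mem_Icc]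
    constructor
    · rintro (rfl | ⟨i, hi, rfl⟩)
      · exact ⟨1, by omega, by simp⟩
      · refine ⟨i - c + 1, by omega, ?_⟩
        rw [if_neg (by omega), if_neg (by omega)]
        congr 1
        omega
    · rintro ⟨i, hi, rfl⟩
      rw [if_neg (by omega)]
      split_ifs with h
      · exact Or.inl rfl
      · exact Or.inr ⟨c + i - 1, by omega, rfl⟩

variable [Finite V]

/-- If `q`, `e₁` and `e₂` each miss less than a third of the connected set `W`, then `q` can replace
a common neighbour of `e₁` and `e₂` in `W`. -/
lemma ConnectedOn.exists_exchange (hW : ConnectedOn G W) {q e₁ e₂ : V} {d : ℕ} (hqW : q ∉ W)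
    (hq : (W \ G.neighborSet q).ncard ≤ d) (h₁ : (W \ G.neighborSet e₁).ncard ≤ d)
    (h₂ : (W \ G.neighborSet e₂).ncard ≤ d) (hd : 3 * d < W.ncard) :
    ∃ w ∈ W, G.Adj w e₁ ∧ G.Adj w e₂ ∧ ConnectedOn G (insert q W \ {w}) := by
  obtain ⟨t, ht, htq⟩ : ∃ t ∈ W, G.Adj t q := by
    by_contra! h
    have : W \ G.neighborSet q = W := by
      ext z
      simp only [Set.mem_sdiff, SimpleGraph.mem_neighborSet, and_iff_left_iff_imp]
      exact fun hz hqz => h z hz hqz.symm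
    rw [this] at hq
    omega
  obtain ⟨π, hπ⟩ := (hW.insert_of_adj ht htq).exists_parents (Set.mem_insert q W)
  have hset : {t ∈ insert q W | t ≠ q ∧ ¬ G.Adj q t} ⊆ W \ G.neighborSet q := by
    rintro z ⟨hz | hz, hzq, hqz⟩
    exacts [absurd hz hzq, ⟨hz, hqz⟩]
  have hbad : (π '' {t ∈ insert q W | t ≠ q ∧ ¬ G.Adj q t}).ncard ≤ d :=
    (Set.ncard_image_le (Set.toFinite _)).trans ((Set.ncard_le_ncard hset).trans hq)
  have hlt : ((π '' {t ∈ insert q W | t ≠ q ∧ ¬ G.Adj q t}) ∪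
      (W \ G.neighborSet e₁ ∪ W \ G.neighborSet e₂)).ncard < W.ncard := by
    have a := Set.ncard_union_le (π '' {t ∈ insert q W | t ≠ q ∧ ¬ G.Adj q t})
      (W \ G.neighborSet e₁ ∪ W \ G.neighborSet e₂)
    have b := Set.ncard_union_le (W \ G.neighborSet e₁) (W \ G.neighborSet e₂)
    omega
  obtain ⟨w, hwW, hw⟩ := Set.exists_mem_notMem_of_ncard_lt_ncard hlt
  simp only [Set.mem_union, Set.mem_sdiff, SimpleGraph.mem_neighborSet, not_or, not_and,
    not_not] at hw
  exact ⟨w, hwW, (hw.2.1 hwW).symm, (hw.2.2 hwW).symm, hπ w (fun h => hqW (h ▸ hwW)) hw.1⟩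

lemma ncard_sdiff_neighborSet_le {m₀ : ℕ} {v p q : V} (hdeg : m₀ + 2 ≤ (G.neighborSet v).ncard)
    (h : ∀ u ∉ W, G.Adj v u → u = p ∨ u = q) :
    m₀ ≤ W.ncard ∧ (W \ G.neighborSet v).ncard ≤ W.ncard - m₀ := by
  have hsub : G.neighborSet v ⊆ (W ∩ G.neighborSet v) ∪ {p, q} := by
    intro u hu
    by_cases huW : u ∈ W
    · exact Or.inl ⟨huW, hu⟩
    · exact Or.inr (h u huW hu)
  have a := Set.ncard_le_ncard hsub
  have b := Set.ncard_union_le (W ∩ G.neighborSet v) {p, q}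
  have c : ({p, q} : Set V).ncard ≤ 2 := ncard_pair_le p q
  have d := Set.ncard_inter_add_ncard_sdiff_eq_ncard W (G.neighborSet v)
  omega

end Exchange

section Main

variable {V : Type*} {G : SimpleGraph V} [Finite V]

/-- A contractible set with fewer than `k` vertices is never of maximum size among those with at
most `k` vertices. -/
lemma exists_larger_contractible (h3 : ∀ p q, ConnectedOn G ({p, q}ᶜ)) {k m₀ : ℕ}
    (hm₀ : 2 * k ≤ 3 * m₀ + 1) (hcard : k + 3 ≤ Nat.card V)
    (hdeg : ∀ v, m₀ + 2 ≤ (G.neighborSet v).ncard) {W : Set V} (hW : ConnectedOn G W)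
    (hWn : NonseparableOn G Wᶜ) (hWk : W.ncard < k) :
    ∃ W', ConnectedOn G W' ∧ NonseparableOn G W'ᶜ ∧ W.ncard < W'.ncard ∧ W'.ncard ≤ k := by
  by_contra! hstuck
  have hext : ∀ a b, a ∉ W → b ∉ W → G.Adj a b → ∃ U x y s f, W ⊂ U ∧ NonseparableOn G Uᶜ ∧
      a ∉ U ∧ b ∉ U ∧ x ≠ y ∧ x ∉ U ∧ y ∉ U ∧ IsEar G (U \ W) x y s f ∧
      U \ W = f '' Set.Icc 1 s ∧ k < W.ncard + s ∧
      (∀ i, 1 ≤ i → i ≤ s → ∀ u ∉ W, G.Adj (f i) u → u = f (i - 1) ∨ u = f (i + 1)) := by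
    intro a b ha hb hab
    obtain ⟨c, -, hc⟩ : ∃ c ∈ Set.univ, c ∉ W ∪ {a, b} := by
      refine Set.exists_mem_notMem_of_ncard_lt_ncard ?_
      rw [Set.ncard_univ]
      have h1 := Set.ncard_union_le W {a, b}
      have h2 : ({a, b} : Set V).ncard ≤ 2 := ncard_pair_le a b
      omega
    simp only [Set.mem_union, Set.mem_insert_iff, Set.mem_singleton_iff, not_or] at hc
    obtain ⟨U, hU⟩ := exists_isMinimalExtension h3 hab ha hb hc.1 hc.2.1 hc.2.2
    obtain ⟨x, y, s, f, hxy, hx, hy, hf, heq, hdeg2⟩ := hU.exists_isEar_eq h3 hW hWn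
    obtain ⟨hWU, hUc, hUn, haU, hbU⟩ := hU.prop
    have hs : (U \ W).ncard = s := by
      rw [heq, hf.ncard_image le_rfl, Nat.add_sub_cancel]
    have hUcard := Set.ncard_sdiff_add_ncard_of_subset hWU.1
    have hks := hstuck U hUc hUn (Set.ncard_lt_ncard hWU)
    exact ⟨U, x, y, s, f, hWU, hUn, haU, hbU, hxy, hx, hy, hf, heq, by omega, hdeg2 (by omega)⟩
  obtain ⟨a, ha⟩ := hWn.1.nonempty
  obtain ⟨b, hb, hba⟩ := hWn.exists_ne a
  obtain ⟨a', rfl, b', hb', -, hab⟩ := hWn.1.exists_adj_boundary (K := {a}) ha rfl hb hba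
  obtain ⟨U, x, y, s, f, hWU, hUn, -, -, hxy, hx, hy, hf, heq, hks, hdeg2⟩ := hext a' b' ha hb' hab
  have hfW : ∀ i, 1 ≤ i → i ≤ s → f i ∉ W := fun i h1 h2 => (hf.mem i h1 h2).2
  obtain ⟨U', x', y', s', f', hWU', hUn', h1U', h2U', -, -, -, hf', heq', hks', hdeg2'⟩ :=
    hext (f 1) (f 2) (hfW 1 le_rfl (by omega)) (hfW 2 (by omega) (by omega)) (hf.adj 1 (by omega))
  have hsmall' : ∀ u ∈ U' \ W, (W \ G.neighborSet u).ncard ≤ W.ncard - m₀ := by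
    intro u hu
    obtain ⟨i, ⟨hi1, his⟩, rfl⟩ := heq'.subset hu
    exact (ncard_sdiff_neighborSet_le (hdeg _) (hdeg2' i hi1 his)).2
  have hsmall : ∀ i, 1 ≤ i → i ≤ s → (W \ G.neighborSet (f i)).ncard ≤ W.ncard - m₀ :=
    fun i hi his => (ncard_sdiff_neighborSet_le (hdeg _) (hdeg2 i hi his)).2
  have hm₀W : m₀ ≤ W.ncard :=
    (ncard_sdiff_neighborSet_le (hdeg _) (hdeg2 1 le_rfl (by omega))).1
  obtain ⟨u₁, u₂, hu, hu₁, hu₂, hu₁', hu₂'⟩ :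
      ∃ u₁ u₂, u₁ ≠ u₂ ∧ u₁ ∉ U ∧ u₂ ∉ U ∧ u₁ ∈ U' \ W ∧ u₂ ∈ U' \ W := by
    by_cases hex : ∃ j, 1 ≤ j ∧ j ≤ s ∧ f j ∈ U'
    · classical
      obtain ⟨hj1, hjs, hjU'⟩ := Nat.find_spec hex
      have hmin : ∀ i, 1 ≤ i → i < Nat.find hex → f i ∉ U' := fun i h1 h2 h =>
        Nat.find_min hex h2 ⟨h1, by omega, h⟩
      generalize Nat.find hex = j at hj1 hjs hjU' hmin
      have hj1' : j ≠ 1 := fun h => h1U' (h ▸ hjU')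
      have hj2' : j ≠ 2 := fun h => h2U' (h ▸ hjU')
      have hB : ∀ o ∉ U', o = f (j - 2) ∨ o = f (j - 1) := by
        intro o ho
        by_contra! hcon
        obtain ⟨_, rfl, z, ⟨hzU', hz⟩, -, hadj⟩ := (hUn'.2 (f (j - 2))).exists_adj_boundary
          (K := {f (j - 1)}) (a := f (j - 1)) (b := o) ⟨hmin (j - 1) (by omega) (by omega), fun h =>
            by have := hf.inj _ _ (by omega) (by omega) h; omega⟩ rfl ⟨ho, hcon.1⟩ hcon.2
        rcases hdeg2 (j - 1) (by omega) (by omega) z (fun h => hzU' (hWU'.1 h)) hadj with h | h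
        · exact hz h
        · rw [Nat.sub_add_cancel hj1] at h
          exact hzU' (h ▸ hjU')
      have hmem : ∀ i, i ≤ s + 1 → i ≠ j - 2 → i ≠ j - 1 → f i ∈ U' := by
        intro i hi h1 h2
        by_contra h
        rcases hB _ h with h | h
        · exact h1 (hf.inj _ _ hi (by omega) h)
        · exact h2 (hf.inj _ _ hi (by omega) h)
      refine ⟨x, y, hxy, hx, hy, ⟨?_, fun h => hx (hWU.1 h)⟩, ⟨?_, fun h => hy (hWU.1 h)⟩⟩
      · rw [← hf.zero]
        exact hmem 0 (by omega) (by omega) (by omega)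
      · rw [← hf.last]
        exact hmem (s + 1) le_rfl (by omega) (by omega)
    · push Not at hex
      have hnot : ∀ i, 1 ≤ i → i ≤ s' → f' i ∉ U := by
        intro i hi his h
        have hm := hf'.mem i hi his
        obtain ⟨j, ⟨hj1, hjs⟩, hj⟩ := heq.subset ⟨h, hm.2⟩
        exact hex j hj1 hjs (hj ▸ hm.1)
      refine ⟨f' 1, f' 2, fun h => ?_, hnot 1 le_rfl (by omega), hnot 2 (by omega) (by omega),
        hf'.mem 1 le_rfl (by omega), hf'.mem 2 (by omega) (by omega)⟩
      have := hf'.inj 1 2 (by omega) (by omega) h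
      omega
  obtain ⟨c, hc⟩ : ∃ c, c = k - W.ncard + 1 := ⟨_, rfl⟩
  obtain ⟨e₁, e₂, he₁, he₂, hNS⟩ := hf.exists_nonseparableOn_tail hWU.1 hUn hy (c := c) (by omega)
    (P := fun u => (W \ G.neighborSet u).ncard ≤ W.ncard - m₀) hsmall hu hu₁ hu₂
    (hsmall' _ hu₁') (hsmall' _ hu₂')
  obtain ⟨w, hwW, hw₁, hw₂, hwc⟩ := hW.exists_exchange (hfW 1 le_rfl (by omega))
    (hsmall 1 le_rfl (by omega)) he₁ he₂ (by omega)
  have hQW : ∀ i, 1 ≤ i → i ≤ c → f i ∉ W := fun i h1 h2 => hfW i h1 (by omega)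
  have hW'card : ((W \ {w}) ∪ f '' Set.Icc 1 c).ncard = k := by
    rw [Set.ncard_union_eq, Set.ncard_sdiff_singleton_of_mem hwW, hf.ncard_image (by omega)]
    · omega
    · rw [Set.disjoint_left]
      rintro _ hz ⟨i, hi, rfl⟩
      exact hQW i hi.1 hi.2 hz.1
  have h1Q : f 1 ∈ f '' Set.Icc 1 c := ⟨1, ⟨le_rfl, by omega⟩, rfl⟩
  have hf1w : f 1 ≠ w := fun h => hQW 1 le_rfl (by omega) (h ▸ hwW)
  have hW'c : ConnectedOn G ((W \ {w}) ∪ f '' Set.Icc 1 c) := by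
    have := hwc.union (hf.connectedOn (i := 1) (j := c) (by omega) (by omega))
      ⟨f 1, ⟨Or.inl rfl, hf1w⟩, h1Q⟩
    convert this using 1
    ext z
    simp only [Set.mem_union, Set.mem_sdiff, Set.mem_insert_iff, Set.mem_singleton_iff]
    constructor
    · tauto
    · rintro (⟨rfl | h, h'⟩ | h)
      exacts [Or.inr h1Q, Or.inl ⟨h, h'⟩, Or.inr h]
  have hcompl : ((W \ {w}) ∪ f '' Set.Icc 1 c)ᶜ = Uᶜ ∪ insert w (f '' Set.Icc (c + 1) s) := by
    ext z
    simp only [Set.mem_compl_iff, Set.mem_union, Set.mem_sdiff, Set.mem_singleton_iff, not_or,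
      Set.mem_insert_iff]
    constructor
    · rintro ⟨hz1, hz2⟩
      by_cases hzw : z = w
      · exact Or.inr (Or.inl hzw)
      by_cases hzU : z ∈ U
      · obtain ⟨i, hi, rfl⟩ := heq.subset ⟨hzU, fun h => hz1 ⟨h, hzw⟩⟩
        refine Or.inr (Or.inr ⟨i, ⟨?_, hi.2⟩, rfl⟩)
        by_contra h
        exact hz2 ⟨i, ⟨hi.1, by omega⟩, rfl⟩
      · exact Or.inl hzU
    · rintro (hz | rfl | ⟨i, ⟨hi1, hi2⟩, rfl⟩)
      · refine ⟨fun h => hz (hWU.1 h.1), fun h => hz ?_⟩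
        exact (hf.image_subset le_rfl (by omega) h).1
      · refine ⟨fun h => h.2 rfl, ?_⟩
        rintro ⟨i, hi, h⟩
        exact hQW i hi.1 hi.2 (h ▸ hwW)
      · refine ⟨fun h => hfW i (by omega) hi2 h.1, ?_⟩
        rintro ⟨j, ⟨hj1, hj2⟩, h⟩
        have := hf.inj _ _ (by omega) (by omega) h
        omega
  exact absurd (hstuck _ hW'c (hcompl ▸ hNS w hwW hw₁ hw₂) (by omega)) (by omega)

lemma exists_contractible_of_ncard_le (h3 : ∀ p q, ConnectedOn G ({p, q}ᶜ)) {k m₀ : ℕ}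
    (hm₀ : 2 * k ≤ 3 * m₀ + 1) (hcard : k + 3 ≤ Nat.card V)
    (hdeg : ∀ v, m₀ + 2 ≤ (G.neighborSet v).ncard) {W : Set V} (hW : ConnectedOn G W)
    (hWn : NonseparableOn G Wᶜ) (hWk : W.ncard ≤ k) :
    ∃ W', ConnectedOn G W' ∧ NonseparableOn G W'ᶜ ∧ W'.ncard = k := by
  induction h : k - W.ncard using Nat.strong_induction_on generalizing W with
  | _ n ih =>
    rcases hWk.eq_or_lt with heq | hlt
    · exact ⟨W, hW, hWn, heq⟩
    · obtain ⟨W', hW', hWn', hlt', hle⟩ :=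
        exists_larger_contractible h3 hm₀ hcard hdeg hW hWn hlt
      exact ih _ (by omega) hW' hWn' hle rfl

lemma NonseparableOn.nConnected_two {Y : Set V} (hY : NonseparableOn G Y) (h : 2 < Y.ncard) :
    NConnected (G.induce Y) 2 := by
  refine ⟨h, fun S hS => ?_⟩
  have hconn : ConnectedOn G (Y \ Subtype.val '' S) := by
    rcases Nat.lt_or_ge S.ncard 1 with h0 | h1
    · rw [(Set.ncard_eq_zero).1 (by omega : S.ncard = 0), Set.image_empty, Set.sdiff_empty]
      exact hY.1
    · obtain ⟨v, rfl⟩ := Set.ncard_eq_one.1 (by omega : S.ncard = 1)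
      rw [Set.image_singleton]
      exact hY.2 v
  let e : ((G.induce Y).induce Sᶜ) ≃g G.induce (Y \ Subtype.val '' S) :=
    { toFun := fun z => ⟨z.1.1, z.1.2, by
        rintro ⟨t, ht, hts⟩
        exact z.2 (Subtype.ext hts ▸ ht)⟩
      invFun := fun z => ⟨⟨z.1, z.2.1⟩, fun h => z.2.2 ⟨_, h, rfl⟩⟩
      left_inv := fun _ => rfl
      right_inv := fun _ => rfl
      map_rel_iff' := Iff.rfl }
  exact e.connected_iff.2 hconn

end Main

/-- Let `G` be a finite `3`-connected simple graph, `k ≥ 5`, `|V(G)| ≥ k + 3`, and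
`δ(G) ≥ ⌊(2k+1)/3⌋ + 2`.  Then `G` has a `k`-contractible set. -/
theorem stmt_0 {V : Type*} [Fintype V] (G : SimpleGraph V) [DecidableRel G.Adj]
    (k : ℕ) (hk : 5 ≤ k) (hG : NConnected G 3)
    (hv : k + 3 ≤ Fintype.card V)
    (hδ : (2 * k + 1) / 3 + 2 ≤ G.minDegree) :
    ∃ W : Set V, W.ncard = k ∧ ContractibleSet G W := by
  have h3 : ∀ p q, ConnectedOn G ({p, q}ᶜ) := fun p q =>
    hG.2 _ (lt_of_le_of_lt (ncard_pair_le p q) (by omega))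
  have hdeg : ∀ v, (2 * k + 1) / 3 + 2 ≤ (G.neighborSet v).ncard := by
    intro v
    rw [← G.coe_neighborFinset, Set.ncard_coe_finset, G.card_neighborFinset_eq_degree]
    exact hδ.trans (G.minDegree_le_degree v)
  have hcard : k + 3 ≤ Nat.card V := by rwa [Nat.card_eq_fintype_card]
  obtain ⟨v⟩ : Nonempty V := Fintype.card_pos_iff.1 (by omega)
  have hv : NonseparableOn G ({v}ᶜ) := by
    refine ⟨by simpa using h3 v v, fun u => ?_⟩
    have : ({v}ᶜ : Set V) \ {u} = {v, u}ᶜ := by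
      ext z
      simp
    rw [this]
    exact h3 v u
  obtain ⟨W, hW, hWn, hWk⟩ := exists_contractible_of_ncard_le h3 (by omega) hcard hdeg
    (connectedOn_singleton v) hv (by rw [Set.ncard_singleton]; omega)
  refine ⟨W, hWk, hW, hWn.nConnected_two ?_⟩
  have := Set.ncard_add_ncard_compl W
  omega
end

section
/- Let k be an integer and c a non-negative integer with k ≥ 3c + 5. Let G be a finite 3-connected simple graph such that G has a (k − 1)-contractible set, |V(G)| ≥ k + 3, and the minimum degree δ(G) ≥ k − c. Then there is a k-contractible set in G. -/
open SimpleGraph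

/-- `X` is a nonempty set, disjoint from `S`, all of whose outer neighbours lie in `S`, and
`X ∪ S` is not everything. -/
def IsFragment {U : Type*} (H : SimpleGraph U) (S X : Set U) : Prop :=
  X.Nonempty ∧ (∃ r, r ∉ X ∧ r ∉ S) ∧ (∀ a ∈ X, a ∉ S) ∧
    ∀ a ∈ X, ∀ b, H.Adj a b → b ∈ X ∨ b ∈ S

/-- `v` has at most two neighbours. -/
def DegLeTwo {U : Type*} (H : SimpleGraph U) (v : U) : Prop :=
  ∃ a b, ∀ c, H.Adj v c → c = a ∨ c = b

namespace IsFragment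

variable {U : Type*} {H : SimpleGraph U}

theorem compl {S X : Set U} (h : IsFragment H S X) :
    IsFragment H S {a | a ∉ X ∧ a ∉ S} := by
  obtain ⟨⟨x, hx⟩, hr, hd, hN⟩ := h
  refine ⟨hr, ⟨x, fun h => h.1 hx, hd x hx⟩, fun a ha => ha.2, fun a ha b hab => ?_⟩
  by_cases hb : b ∈ S
  · exact Or.inr hb
  · refine Or.inl ⟨fun hbX => ?_, hb⟩
    rcases hN b hbX a hab.symm with h | h
    · exact ha.1 h
    · exact ha.2 h

/-- A fragment of a `2`-separator that is minimal with respect to separators through one of its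
vertices `v` is the singleton `{v}`, as soon as `v` lies in some `2`-separator. -/
theorem eq_singleton
    (h2 : ∀ S X : Set U, S.Subsingleton → ¬ IsFragment H S X)
    {x y v z : U} {X Y : Set U} (hX : IsFragment H {x, y} X) (hY : IsFragment H {v, z} Y)
    (hv : v ∈ X) (hvz : v ≠ z)
    (hmin : ∀ s Z, Z ⊆ X → v ∉ Z → ¬ IsFragment H {v, s} Z) : X = {v} := by
  have meets : ∀ Y, IsFragment H {v, z} Y → x ∈ Y ∨ y ∈ Y := by
    intro Y hY
    by_contra! hxy
    obtain ⟨⟨a, ha⟩, hYr, hYd, hYN⟩ := hY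
    obtain ⟨-, hXr, hXd, hXN⟩ := hX
    by_cases haX : a ∈ X
    · refine hmin z (X ∩ Y) Set.inter_subset_left (fun h => hYd v h.2 (by simp)) ?_
      refine ⟨⟨a, haX, ha⟩, ?_, ?_, ?_⟩
      · obtain ⟨r, h1, h3⟩ := hYr
        exact ⟨r, fun h => h1 h.2, h3⟩
      · exact fun b hb => hYd b hb.2
      · intro c hc b hcb
        have h1 := hXN c hc.1 b hcb
        have h3 := hYN c hc.2 b hcb
        grind
    · refine h2 {z} (Y \ X) Set.subsingleton_singleton ⟨⟨a, ha, haX⟩, ⟨v, ?_, ?_⟩, ?_, ?_⟩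
      · exact fun h => h.2 hv
      · simpa using hvz
      · intro b hb
        have := hYd b hb.1
        grind
      · intro c hc b hcb
        have h1 := hYN c hc.1 b hcb
        have h3 := fun hb => hXN b hb c hcb.symm
        grind
  have key : ∀ Y, IsFragment H {v, z} Y → x ∈ Y → y ∉ Y → y ∉ ({v, z} : Set U) → X = {v} := by
    intro Y hY hxY hyY hyT
    have hY' := hY.compl
    obtain ⟨-, hYr, hYd, hYN⟩ := hY
    obtain ⟨-, -, hYd', hYN'⟩ := hY'
    have hX' := hX
    obtain ⟨-, ⟨r, hrX, hrS⟩, hXd, hXN⟩ := hX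
    obtain ⟨-, -, -, hXN'⟩ := hX'.compl
    by_cases hz : z ∈ X
    · exfalso
      by_cases hrY : r ∈ Y
      · refine h2 {x} {a | a ∈ Y ∧ a ∉ X ∧ a ≠ x} Set.subsingleton_singleton
          ⟨⟨r, hrY, hrX, by grind⟩, ⟨v, by grind, by grind⟩, by grind, ?_⟩
        intro c hc b hcb
        have h1 := hYN c hc.1 b hcb
        have h3 := hXN' c ⟨hc.2.1, by grind⟩ b hcb
        grind
      · refine h2 {y} {a | a ∉ Y ∧ a ∉ X ∧ a ≠ y} Set.subsingleton_singleton
          ⟨⟨r, hrY, hrX, by grind⟩, ⟨v, by grind, by grind⟩, by grind, ?_⟩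
        intro c hc b hcb
        have h1 := hYN' c ⟨hc.1, by grind⟩ b hcb
        have h3 := hXN' c ⟨hc.2.1, by grind⟩ b hcb
        grind
    · by_contra hne
      obtain ⟨w, hw, hwv⟩ : ∃ w ∈ X, w ≠ v := by
        by_contra! h
        exact hne (Set.eq_singleton_iff_unique_mem.2 ⟨hv, h⟩)
      by_cases hwY : w ∈ Y
      · refine hmin x (X ∩ Y) Set.inter_subset_left (by grind)
          ⟨⟨w, hw, hwY⟩, ⟨y, by grind, by grind⟩, by grind, ?_⟩
        intro c hc b hcb
        have h1 := hXN c hc.1 b hcb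
        have h3 := hYN c hc.2 b hcb
        grind
      · refine hmin y {a | a ∈ X ∧ a ∉ Y ∧ a ≠ v} (by grind) (by grind)
          ⟨⟨w, hw, hwY, hwv⟩, ⟨x, by grind, by grind⟩, by grind, ?_⟩
        intro c hc b hcb
        have h1 := hXN c hc.1 b hcb
        have h3 := hYN' c ⟨hc.2.1, by grind⟩ b hcb
        grind
  rcases meets Y hY with h | h <;> rcases meets _ hY.compl with h' | h'
  · exact absurd h h'.1
  · exact key Y hY h h'.1 h'.2
  · exact key _ hY.compl h' (fun h3 => h3.1 h) (hY.2.2.1 y h)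
  · exact absurd h h'.1

end IsFragment

/-- The properties of `G - W`, with `A` the set of vertices adjacent to `W`, when no vertex of `A`
can be moved to `W` keeping `2`-connectedness. -/
structure IsCritical {U : Type*} (H : SimpleGraph U) (A : Set U) : Prop where
  two_conn : ∀ S X : Set U, S.Subsingleton → ¬ IsFragment H S X
  meets : ∀ x y X, IsFragment H {x, y} X → ∃ v ∈ X, v ∈ A
  critical : ∀ v ∈ A, ∃ z Y, IsFragment H {v, z} Y
  degLeTwo_mem : ∀ v, DegLeTwo H v → v ∈ A
  nonempty : A.Nonempty
  card : 4 ≤ Nat.card U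

namespace IsCritical

variable {U : Type*} {H : SimpleGraph U} {A : Set U}

theorem ne_of_isFragment (h : IsCritical H A) {x y : U} {X : Set U}
    (hX : IsFragment H {x, y} X) : x ≠ y := by
  rintro rfl
  exact h.two_conn {x, x} X (by simp) hX

theorem exists_degLeTwo [Finite U] (h : IsCritical H A) {x y : U} {X : Set U}
    (hX : IsFragment H {x, y} X) : ∃ v ∈ X, DegLeTwo H v := by
  induction hn : X.ncard using Nat.strong_induction_on generalizing x y X with
  | _ n ih =>
    obtain ⟨v, hvX, hvA⟩ := h.meets x y X hX
    obtain ⟨z, Y, hY⟩ := h.critical v hvA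
    by_cases hmin : ∃ s Z, Z ⊆ X ∧ v ∉ Z ∧ IsFragment H {v, s} Z
    · obtain ⟨s, Z, hZX, hvZ, hZ⟩ := hmin
      have hlt : Z.ncard < X.ncard :=
        Set.ncard_lt_ncard ⟨hZX, fun h => hvZ (h hvX)⟩
      obtain ⟨w, hw, hw2⟩ := ih _ (hn ▸ hlt) hZ rfl
      exact ⟨w, hZX hw, hw2⟩
    · push Not at hmin
      have := hX.eq_singleton h.two_conn hY hvX (h.ne_of_isFragment hY) hmin
      subst this
      refine ⟨v, rfl, x, y, fun c hc => ?_⟩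
      have h1 := hX.2.2.2 v rfl c hc
      have h3 := hc.ne
      grind

theorem exists_isFragment_singleton [Finite U] (h : IsCritical H A) {v z : U} {X : Set U}
    (hv : DegLeTwo H v) (hX : IsFragment H {v, z} X) :
    ∃ v z x, DegLeTwo H v ∧ IsFragment H {v, z} {x} := by
  induction hn : X.ncard using Nat.strong_induction_on generalizing v z X with
  | _ n ih =>
    obtain ⟨w, hwX, hw⟩ := h.exists_degLeTwo hX
    obtain ⟨t, Y, hY⟩ := h.critical w (h.degLeTwo_mem w hw)
    by_cases hmin : ∃ s Z, Z ⊆ X ∧ w ∉ Z ∧ IsFragment H {w, s} Z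
    · obtain ⟨s, Z, hZX, hvZ, hZ⟩ := hmin
      have hlt : Z.ncard < X.ncard :=
        Set.ncard_lt_ncard ⟨hZX, fun h => hvZ (h hwX)⟩
      exact ih _ (hn ▸ hlt) hw hZ rfl
    · push Not at hmin
      have := hX.eq_singleton h.two_conn hY hwX (h.ne_of_isFragment hY) hmin
      subst this
      exact ⟨v, z, w, hv, hX⟩

end IsCritical

/-- `u p q z` is a path whose inner vertices `p` and `q` have no other neighbours. -/
structure IsHandle {U : Type*} (H : SimpleGraph U) (p q u z : U) : Prop where
  adj : H.Adj p q
  left : ∀ c, H.Adj p c → c = q ∨ c = u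
  right : ∀ c, H.Adj q c → c = p ∨ c = z
  ne_ends : u ≠ z
  up : u ≠ p
  uq : u ≠ q
  zp : z ≠ p
  zq : z ≠ q

theorem IsHandle.symm {U : Type*} {H : SimpleGraph U} {p q u z : U} (h : IsHandle H p q u z) :
    IsHandle H q p z u :=
  ⟨h.adj.symm, h.right, h.left, h.ne_ends.symm, h.zq, h.zp, h.uq, h.up⟩

/-- `C` is the side of `u` when the vertex `t` separates `u` from `z` in `H - {p, q}`. -/
structure IsSide {U : Type*} (H : SimpleGraph U) (p q u z t : U) (C : Set U) : Prop where
  t_notMem : t ∉ C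
  tp : t ≠ p
  tq : t ≠ q
  tz : t ≠ z
  p_notMem : p ∉ C
  q_notMem : q ∉ C
  u_mem : u ∈ C
  z_notMem : z ∉ C
  closed : ∀ a ∈ C, ∀ b, H.Adj a b → b ∈ C ∨ b = t ∨ b = p

namespace IsCritical

variable {U : Type*} {H : SimpleGraph U} {A : Set U}

theorem exists_isHandle [Finite U] (h : IsCritical H A) : ∃ p q u z, IsHandle H p q u z := by
  obtain ⟨v₀, hv₀⟩ := h.nonempty
  obtain ⟨z₀, Y, hY⟩ := h.critical v₀ hv₀
  obtain ⟨v₁, -, hv₁⟩ := h.exists_degLeTwo hY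
  obtain ⟨z₁, Y₁, hY₁⟩ := h.critical v₁ (h.degLeTwo_mem v₁ hv₁)
  obtain ⟨p, z, q, hp, hq⟩ := h.exists_isFragment_singleton hv₁ hY₁
  have hpz := h.ne_of_isFragment hq
  obtain ⟨-, hr, hd, hN⟩ := hq
  have hqS := hd q rfl
  have hqN : ∀ c, H.Adj q c → c = p ∨ c = z := by
    intro c hc
    have h1 := hN q rfl c hc
    have h3 := hc.ne
    grind
  have hqp : H.Adj p q := by
    by_contra hnot
    refine h.two_conn {z} {q} Set.subsingleton_singleton
      ⟨⟨q, rfl⟩, ⟨p, by grind, by grind⟩, by grind, ?_⟩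
    rintro a rfl b hab
    have h1 := hqN b hab
    have h3 := hab.symm
    grind
  obtain ⟨u, hu⟩ : ∃ u, ∀ c, H.Adj p c → c = q ∨ c = u := by
    obtain ⟨a, b, hab⟩ := hp
    rcases hab q hqp with rfl | rfl
    · exact ⟨b, hab⟩
    · exact ⟨a, fun c hc => (hab c hc).symm⟩
  have hubad : ¬ (u = z ∨ u = p ∨ u = q) := by
    intro hbad
    obtain ⟨r, hr⟩ : ∃ r, r ∉ ({p, q, z} : Set U) := by
      by_contra! hall
      have h1 : ({p, q, z} : Set U) = Set.univ := Set.eq_univ_of_forall hall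
      have h3 : ({p, q, z} : Set U).ncard ≤ 3 := by
        have := Set.ncard_insert_le p {q, z}
        have := Set.ncard_insert_le q {z}
        have := Set.ncard_singleton z
        omega
      rw [h1, Set.ncard_univ] at h3
      have := h.card
      omega
    refine h.two_conn {z} {p, q} Set.subsingleton_singleton
      ⟨⟨p, by simp⟩, ⟨r, by grind, by grind⟩, by grind, ?_⟩
    intro a ha b hab
    have h1 := hqN b
    have h3 := hu b
    have : a = p ∨ a = q := by simpa using ha
    rcases this with rfl | rfl <;> grind
  exact ⟨p, q, u, z, hqp, hu, hqN, by grind, by grind, by grind, by grind, by grind⟩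

end IsCritical

namespace IsSide

variable {U : Type*} {H : SimpleGraph U} {A : Set U} {p q u z t : U} {C : Set U}

theorem dual (hP : IsHandle H p q u z) (h : IsSide H p q u z t C) :
    IsSide H q p z u t {a | a ∉ C ∧ a ≠ t ∧ a ≠ p ∧ a ≠ q} := by
  have := h.t_notMem
  have := h.u_mem
  have := h.z_notMem
  have := h.tz
  have := hP.zp
  have := hP.zq
  refine ⟨by grind, h.tq, h.tp, by grind, by grind, by grind, by grind, by grind, ?_⟩
  intro a ha b hab
  have h1 := fun hb => h.closed b hb a hab.symm
  have h3 := fun hb : b = p => hP.left a (hb ▸ hab.symm)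
  grind

theorem exists_common [Finite U] (hA : IsCritical H A) (hP : IsHandle H p q u z)
    (h : IsSide H p q u z t C) :
    ∃ y, DegLeTwo H y ∧ ∀ t C, IsSide H p q u z t C → y ∈ C := by
  obtain ⟨C, ⟨t, hC⟩, hmin⟩ := (measure (fun C : Set U => C.ncard)).wf.has_min
    {C | ∃ t, IsSide H p q u z t C} ⟨C, t, h⟩
  have hsub : ∀ s D, IsSide H p q u z s D → C ⊆ D := by
    intro s D hD a ha
    have hsC : s ∉ C := by
      intro hsC
      by_cases htD : t ∈ D
      · refine hA.two_conn {p} {b | b ∉ C ∧ b ∉ D ∧ b ≠ p} Set.subsingleton_singleton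
          ⟨⟨z, hC.z_notMem, hD.z_notMem, hP.zp⟩, ⟨t, by grind, hC.tp⟩, by grind, ?_⟩
        intro c hc b hcb
        have h1 := fun hb => hC.closed b hb c hcb.symm
        have h3 := fun hb => hD.closed b hb c hcb.symm
        have := hC.t_notMem
        grind
      · refine hmin (C ∩ D) ⟨s, ?_⟩
          (Set.ncard_lt_ncard ⟨Set.inter_subset_left, fun h => hD.t_notMem (h hsC).2⟩)
        have := hC.p_notMem
        have := hC.q_notMem
        have := hC.z_notMem
        have := hC.u_mem
        have := hD.u_mem
        have := hD.t_notMem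
        refine ⟨by grind, hD.tp, hD.tq, hD.tz, by grind, by grind, by grind, by grind, ?_⟩
        intro a ha b hab
        have h1 := hC.closed a ha.1 b hab
        have h3 := hD.closed a ha.2 b hab
        grind
    by_contra haD
    have := hC.p_notMem
    have := hC.q_notMem
    have := hD.u_mem
    have := hC.t_notMem
    refine hA.two_conn {t} (C \ D) Set.subsingleton_singleton
      ⟨⟨a, ha, haD⟩, ⟨p, by grind, hC.tp.symm⟩, by grind, ?_⟩
    intro c hc b hcb
    have h1 := hC.closed c hc.1 b hcb
    have h3 := fun hb => hD.closed b hb c hcb.symm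
    have h4 := fun hb : b = p => hP.left c (hb ▸ hcb.symm)
    grind
  suffices ∃ y ∈ C, DegLeTwo H y by
    obtain ⟨y, hy, hy2⟩ := this
    exact ⟨y, hy2, fun s D hD => hsub s D hD hy⟩
  have := hC.p_notMem
  have := hC.q_notMem
  have := hC.t_notMem
  have := hC.u_mem
  have := hC.tp
  by_cases hCu : ∃ a ∈ C, a ≠ u
  · obtain ⟨a, ha, hau⟩ := hCu
    have hF : IsFragment H {u, t} (C \ {u}) := by
      refine ⟨⟨a, ha, hau⟩, ⟨p, by grind, by grind⟩, by grind, ?_⟩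
      intro c hc b hcb
      have h1 := hC.closed c hc.1 b hcb
      have h4 := fun hb : b = p => hP.left c (hb ▸ hcb.symm)
      grind
    obtain ⟨y, hy, hy2⟩ := hA.exists_degLeTwo hF
    exact ⟨y, hy.1, hy2⟩
  · push Not at hCu
    refine ⟨u, hC.u_mem, t, p, fun c hc => ?_⟩
    have h1 := hC.closed u hC.u_mem c hc
    have h3 := hc.ne
    grind

end IsSide

namespace IsCritical

variable {U : Type*} {H : SimpleGraph U} {A : Set U} {p q u z : U}

theorem adj_right (hA : IsCritical H A) (hP : IsHandle H p q u z) : H.Adj q z := by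
  by_contra hnot
  refine hA.two_conn {p} {q} Set.subsingleton_singleton
    ⟨⟨q, rfl⟩, ⟨u, hP.uq, hP.up⟩, ?_, ?_⟩
  · rintro a rfl
    exact hP.adj.ne'
  · rintro a rfl b hab
    rcases hP.right b hab with rfl | rfl
    · exact Or.inr rfl
    · exact absurd hab hnot

theorem exists_isSide (hA : IsCritical H A) (hP : IsHandle H p q u z) {y : U} {Y : Set U}
    (hy : y ≠ q ∧ y ≠ u ∧ y ≠ z) (hY : IsFragment H {y, p} Y) :
    ∃ C, IsSide H p q u z y C := by
  wlog hqY : q ∉ Y generalizing Y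
  · exact this hY.compl fun h => hqY fun h' => h.1 h'
  have hyp := hA.ne_of_isFragment hY
  have hpq := hP.adj.ne
  have hup := hP.up
  have hzp := hP.zp
  obtain ⟨hne, -, hd, hN⟩ := id hY
  have huY : u ∈ Y := by
    by_contra huY
    refine hA.two_conn {y} Y Set.subsingleton_singleton
      ⟨hne, ⟨q, hqY, by grind⟩, by grind, ?_⟩
    intro a ha b hab
    have h1 := hN a ha b hab
    have h3 := fun hb : b = p => hP.left a (hb ▸ hab.symm)
    grind
  have hzY : z ∉ Y := fun hzY => by
    have := hN z hzY q (hA.adj_right hP).symm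
    grind
  exact ⟨Y, by grind, hyp, by grind, by grind, by grind, hqY, huY, hzY,
    fun a ha b hab => by have := hN a ha b hab; grind⟩

theorem exists_pair_of_not_isSide [Finite U] (hA : IsCritical H A) (hP : IsHandle H p q u z)
    (hno : ∀ t C, ¬ IsSide H p q u z t C) :
    ∃ y y', y ≠ y' ∧ DegLeTwo H y ∧ DegLeTwo H y' ∧ (y ≠ p ∧ y ≠ q) ∧ (y' ≠ p ∧ y' ≠ q) := by
  obtain ⟨hpq, hL, hR, huz, hup, huq, hzp, hzq⟩ := id hP
  have hpq' := hpq.ne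
  by_cases hr : ∃ r, r ≠ p ∧ r ≠ q ∧ r ≠ u ∧ r ≠ z
  · obtain ⟨r, hr⟩ := hr
    have hF : IsFragment H {u, z} {a | a ≠ p ∧ a ≠ q ∧ a ≠ u ∧ a ≠ z} := by
      refine ⟨⟨r, hr⟩, ⟨p, by grind, by grind⟩, by grind, ?_⟩
      intro a ha b hab
      have h1 := fun hb : b = p => hL a (hb ▸ hab.symm)
      have h3 := fun hb : b = q => hR a (hb ▸ hab.symm)
      grind
    obtain ⟨y, ⟨hyp, hyq, hyu, hyz⟩, hy2⟩ := hA.exists_degLeTwo hF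
    obtain ⟨t, Y, hY⟩ := hA.critical y (hA.degLeTwo_mem y hy2)
    have hyt := hA.ne_of_isFragment hY
    have htp : t ≠ p := by
      rintro rfl
      obtain ⟨C, hC⟩ := hA.exists_isSide hP ⟨hyq, hyu, hyz⟩ hY
      exact hno _ _ hC
    have htq : t ≠ q := by
      rintro rfl
      obtain ⟨C, hC⟩ := hA.exists_isSide hP.symm ⟨hyp, hyz, hyu⟩ hY
      exact hno _ _ (hC.dual hP.symm)
    obtain ⟨Y, hY, hpY⟩ : ∃ Y, IsFragment H {y, t} Y ∧ p ∉ Y := by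
      by_cases hpY : p ∈ Y
      · exact ⟨_, hY.compl, fun h => h.1 hpY⟩
      · exact ⟨Y, hY, hpY⟩
    have hqY : q ∉ Y := fun hqY => by
      have := hY.2.2.2 q hqY p hpq.symm
      grind
    obtain ⟨y', hy', hy2'⟩ := hA.exists_degLeTwo hY
    have := hY.2.2.1 y' hy'
    exact ⟨y, y', by grind, hy2, hy2', by grind, by grind⟩
  · push Not at hr
    refine ⟨u, z, huz, ⟨p, z, fun c hc => ?_⟩, ⟨q, u, fun c hc => ?_⟩, ⟨hup, huq⟩, ⟨hzp, hzq⟩⟩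
    · have := hr c
      have := hR u
      have := hc.ne
      have := hc.symm
      grind
    · have := hr c
      have := hL z
      have := hc.ne
      have := hc.symm
      grind

/-- The structural statement about `G - W` used to exchange vertices with `W`. -/
theorem exists_exchange [Finite U] (hA : IsCritical H A) :
    ∃ p q y y', H.Adj p q ∧ DegLeTwo H p ∧ DegLeTwo H q ∧ DegLeTwo H y ∧ DegLeTwo H y' ∧
      y ≠ y' ∧ (y ≠ p ∧ y ≠ q) ∧ (y' ≠ p ∧ y' ≠ q) ∧
      (∀ Z : Set U, Z.Nonempty → p ∉ Z → q ∉ Z →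
        (∀ a ∈ Z, ∀ b, H.Adj a b → b ∈ Z ∨ b = p ∨ b = q) → ∀ b, b ≠ p → b ≠ q → b ∈ Z) ∧
      ∀ (t : U) (Z : Set U), Z.Nonempty → t ≠ p → t ≠ q → t ∉ Z → p ∉ Z → q ∉ Z →
        (∀ a ∈ Z, ∀ b, H.Adj a b → b ∈ Z ∨ b = t ∨ b = p ∨ b = q) → y ∈ Z ∨ y' ∈ Z := by
  obtain ⟨p, q, u, z, hP⟩ := hA.exists_isHandle
  obtain ⟨y, y', hyy, hy, hy', hyP, hyP', hyC, hyC'⟩ : ∃ y y', y ≠ y' ∧ DegLeTwo H y ∧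
      DegLeTwo H y' ∧ (y ≠ p ∧ y ≠ q) ∧ (y' ≠ p ∧ y' ≠ q) ∧
      (∀ t C, IsSide H p q u z t C → y ∈ C) ∧ ∀ t C, IsSide H q p z u t C → y' ∈ C := by
    by_cases hs : ∃ t C, IsSide H p q u z t C
    · obtain ⟨t, C, hC⟩ := hs
      have hD := hC.dual hP
      obtain ⟨y, hy, hyC⟩ := hC.exists_common hA hP
      obtain ⟨y', hy', hyC'⟩ := hD.exists_common hA hP.symm
      have h1 := hyC t C hC
      have h3 := hyC' t _ hD
      have := hC.p_notMem
      have := hC.q_notMem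
      exact ⟨y, y', by grind, hy, hy', by grind, by grind, hyC, hyC'⟩
    · push Not at hs
      obtain ⟨y, y', h1, h3, h4, h5, h6⟩ := hA.exists_pair_of_not_isSide hP hs
      exact ⟨y, y', h1, h3, h4, h5, h6, fun t C hC => absurd hC (hs t C),
        fun t C hC => absurd (hC.dual hP.symm) (hs t _)⟩
  obtain ⟨hpq, hL, hR, huz, hup, huq, hzp, hzq⟩ := id hP
  have hpq' := hpq.ne
  refine ⟨p, q, y, y', hpq, ⟨q, u, hL⟩, ⟨p, z, hR⟩, hy, hy', hyy, hyP, hyP', ?_, ?_⟩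
  · intro Z hZ hpZ hqZ hN b hbp hbq
    by_contra hbZ
    by_cases hu : u ∈ Z
    · by_cases hz : z ∈ Z
      · refine hA.two_conn ∅ (Z ∪ {p, q}) Set.subsingleton_empty
          ⟨⟨p, by simp⟩, ⟨b, by grind, by grind⟩, by grind, ?_⟩
        intro c hc d hcd
        have h1 := fun hc => hN c hc d hcd
        have h3 := hL d
        have h4 := hR d
        grind
      · refine hA.two_conn {p} Z Set.subsingleton_singleton
          ⟨hZ, ⟨b, hbZ, hbp⟩, by grind, ?_⟩
        intro c hc d hcd
        have h1 := hN c hc d hcd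
        have h4 := fun hb : d = q => hR c (hb ▸ hcd.symm)
        grind
    · refine hA.two_conn {q} Z Set.subsingleton_singleton
        ⟨hZ, ⟨b, hbZ, hbq⟩, by grind, ?_⟩
      intro c hc d hcd
      have h1 := hN c hc d hcd
      have h4 := fun hb : d = p => hL c (hb ▸ hcd.symm)
      grind
  · intro t Z hZ htp htq htZ hpZ hqZ hN
    by_contra! hnot
    have hall : ¬ ∀ b, b ∉ Z → b = t ∨ b = p ∨ b = q := by
      intro hall
      have := hall y
      have := hall y'
      grind
    push Not at hall
    obtain ⟨b, hbZ, hbt, hbp, hbq⟩ := hall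
    have hcross : ∀ c d, H.Adj c d → c ∉ Z → c ≠ t → c ≠ p → c ≠ q → d ∉ Z :=
      fun c d hcd h1 h3 h4 h5 hd => by
        have := hN d hd c hcd.symm
        grind
    by_cases hu : u ∈ Z
    · by_cases hz : z ∈ Z
      · refine hA.two_conn {t} (Z ∪ {p, q}) Set.subsingleton_singleton
          ⟨⟨p, by simp⟩, ⟨b, by grind, by grind⟩, by grind, ?_⟩
        intro c hc d hcd
        have h1 := fun hc => hN c hc d hcd
        have h3 := hL d
        have h4 := hR d
        grind
      · by_cases hzt : z = t
        · subst hzt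
          refine hA.two_conn {z} {c | c ∉ Z ∧ c ≠ z ∧ c ≠ p ∧ c ≠ q}
            Set.subsingleton_singleton
            ⟨⟨b, by grind⟩, ⟨p, by grind, by grind⟩, by grind, ?_⟩
          intro c hc d hcd
          have h1 := hcross c d hcd
          have h3 := fun hb : d = p => hL c (hb ▸ hcd.symm)
          have h4 := fun hb : d = q => hR c (hb ▸ hcd.symm)
          grind
        · refine hnot.1 (hyC t Z ⟨htZ, htp, htq, by grind, hpZ, hqZ, hu, hz, ?_⟩)
          intro c hc d hcd
          have h1 := hN c hc d hcd
          have h4 := fun hb : d = q => hR c (hb ▸ hcd.symm)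
          grind
    · by_cases hz : z ∈ Z
      · by_cases hut : u = t
        · subst hut
          refine hA.two_conn {u} {c | c ∉ Z ∧ c ≠ u ∧ c ≠ p ∧ c ≠ q}
            Set.subsingleton_singleton
            ⟨⟨b, by grind⟩, ⟨p, by grind, by grind⟩, by grind, ?_⟩
          intro c hc d hcd
          have h1 := hcross c d hcd
          have h3 := fun hb : d = p => hL c (hb ▸ hcd.symm)
          have h4 := fun hb : d = q => hR c (hb ▸ hcd.symm)
          grind
        · refine hnot.2 (hyC' t Z ⟨htZ, htq, htp, by grind, hqZ, hpZ, hz, hu, ?_⟩)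
          intro c hc d hcd
          have h1 := hN c hc d hcd
          have h4 := fun hb : d = p => hL c (hb ▸ hcd.symm)
          grind
      · refine hA.two_conn {t} Z Set.subsingleton_singleton
          ⟨hZ, ⟨b, hbZ, hbt⟩, by grind, ?_⟩
        intro c hc d hcd
        have h1 := hN c hc d hcd
        have h3 := fun hb : d = p => hL c (hb ▸ hcd.symm)
        have h4 := fun hb : d = q => hR c (hb ▸ hcd.symm)
        grind

end IsCritical

section Connectivity

variable {V : Type*} (G : SimpleGraph V)

theorem connected_induce_iff_forall_closed (S : Set V) :
    (G.induce S).Connected ↔ S.Nonempty ∧ ∀ X ⊆ S, X.Nonempty →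
      (∀ a ∈ X, ∀ b ∈ S, G.Adj a b → b ∈ X) → S ⊆ X := by
  constructor
  · intro h
    refine ⟨Set.nonempty_coe_sort.1 h.nonempty, fun X hXS ⟨x, hx⟩ hcl b hb => ?_⟩
    have key : ∀ c d : S, (G.induce S).Reachable c d → (c : V) ∈ X → (d : V) ∈ X := by
      rintro c d ⟨p⟩
      induction p with
      | nil => exact id
      | cons hadj _ ih => exact fun hc => ih (hcl _ hc _ (Subtype.coe_prop _) hadj)
    exact key ⟨x, hXS hx⟩ ⟨b, hb⟩ (h.preconnected _ _) hx
  · rintro ⟨⟨s, hs⟩, h⟩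
    refine (connected_iff_exists_forall_reachable _).2 ⟨⟨s, hs⟩, fun b => ?_⟩
    have := h {a | ∃ ha : a ∈ S, (G.induce S).Reachable ⟨s, hs⟩ ⟨a, ha⟩} (fun a ha => ha.1)
      ⟨s, hs, Reachable.refl _⟩ ?_ b.2
    · exact this.2
    · rintro a ⟨ha, har⟩ b hb hab
      exact ⟨hb, har.trans (Adj.reachable (by simpa using hab))⟩

variable {G}

theorem NConnected.not_isFragment {n : ℕ} (h : NConnected G n) {S X : Set V} (hS : S.ncard < n) :
    ¬ IsFragment G S X := by
  rintro ⟨hne, ⟨r, hrX, hrS⟩, hd, hN⟩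
  refine hrX (((connected_induce_iff_forall_closed G _).1 (h.2 S hS)).2 X hd hne ?_ hrS)
  intro a ha b hb hab
  exact (hN a ha b hab).resolve_right hb

theorem nConnected_two_induce [Finite V] {U : Set V} (hU : 3 ≤ U.ncard)
    (h : ∀ S X : Set V, S.Subsingleton → X ⊆ U \ S → X.Nonempty →
      (∀ a ∈ X, ∀ b ∈ U \ S, G.Adj a b → b ∈ X) → U \ S ⊆ X) :
    NConnected (G.induce U) 2 := by
  refine ⟨hU, fun S hS => ?_⟩
  refine (connected_induce_iff_forall_closed _ _).2 ⟨?_, fun X hX hne hcl b hb => ?_⟩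
  · rw [Set.nonempty_compl]
    rintro rfl
    rw [Set.ncard_univ] at hS
    have : 3 ≤ Nat.card U := hU
    omega
  · have hsub : S.Subsingleton := Set.ncard_le_one_iff_subsingleton.1 (by omega)
    have := h (Subtype.val '' S) (Subtype.val '' X) (hsub.image _) ?_ (hne.image _) ?_
      (a := b.1) ⟨b.2, ?_⟩
    · simpa using this
    · rintro _ ⟨a, ha, rfl⟩
      have := hX ha
      exact ⟨a.2, by simpa using this⟩
    · rintro _ ⟨a, ha, rfl⟩ c ⟨hcU, hcS⟩ hac
      exact ⟨⟨c, hcU⟩, hcl a ha ⟨c, hcU⟩ (fun hc => hcS ⟨_, hc, rfl⟩) hac, rfl⟩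
    · simpa using hb

/-- In a connected graph, all vertices other than `r` can be removed keeping connectedness, with
at most as many exceptions as there are non-neighbours of `r`. -/
theorem exists_removable [Finite V] {S : Set V} (hS : (G.induce S).Connected) {r : V}
    (hr : r ∈ S) : ∃ T : Set V, T.ncard ≤ {v | v ∈ S ∧ v ≠ r ∧ ¬ G.Adj r v}.ncard ∧
      ∀ w, w ≠ r → w ∉ T → (G.induce (S \ {w})).Connected := by
  classical
  have hpar : ∀ v : S, v.1 ≠ r → ∃ u : S, G.Adj u v ∧
      (G.induce S).dist ⟨r, hr⟩ u < (G.induce S).dist ⟨r, hr⟩ v := by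
    intro v hv
    obtain ⟨p, hp⟩ := (hS.preconnected v ⟨r, hr⟩).exists_walk_length_eq_dist
    cases p with
    | nil => exact absurd rfl hv
    | @cons _ u _ hadj p =>
      refine ⟨u, hadj.symm, ?_⟩
      rw [SimpleGraph.dist_comm, SimpleGraph.dist_comm (v := v), ← hp, Walk.length_cons]
      exact Nat.lt_succ_of_le (SimpleGraph.dist_le p)
  choose! π hπ using hpar
  let f : V → V := fun v => if h : v ∈ S then π ⟨v, h⟩ else v
  refine ⟨f '' {v | v ∈ S ∧ v ≠ r ∧ ¬ G.Adj r v}, Set.ncard_image_le (Set.toFinite _), ?_⟩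
  intro w hwr hwT
  refine (connected_induce_iff_forall_closed _ _).2 ⟨⟨r, hr, hwr.symm⟩, fun X hX ⟨x, hx⟩ hcl => ?_⟩
  have hsymm : ∀ a ∈ S \ {w}, ∀ b ∈ S \ {w}, G.Adj a b → (a ∈ X ↔ b ∈ X) :=
    fun a ha b hb hab => ⟨fun h => hcl a h b hb hab, fun h => hcl b h a ha hab.symm⟩
  have key : ∀ n, ∀ v : S, (G.induce S).dist ⟨r, hr⟩ v = n → v.1 ≠ w → (v.1 ∈ X ↔ r ∈ X) := by
    intro n
    induction n using Nat.strong_induction_on with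
    | _ n ih =>
      intro v hvn hvw
      by_cases hvr : v.1 = r
      · rw [hvr]
      by_cases hadj : G.Adj r v
      · exact (hsymm r ⟨hr, hwr.symm⟩ v ⟨v.2, hvw⟩ hadj).symm
      · obtain ⟨h1, h3⟩ := hπ v hvr
        have hne : (π v).1 ≠ w := by
          rintro h
          refine hwT ⟨v, ⟨v.2, hvr, hadj⟩, ?_⟩
          simp [f, h]
        rw [← hsymm _ ⟨(π v).2, hne⟩ v ⟨v.2, hvw⟩ h1]
        exact ih _ (hvn ▸ h3) _ rfl hne
  intro b hb
  rw [key _ ⟨b, hb.1⟩ rfl hb.2]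
  exact (key _ ⟨x, (hX hx).1⟩ rfl (hX hx).2).1 hx

theorem connected_induce_insert {S : Set V} (hS : (G.induce S).Connected) {s v : V} (hs : s ∈ S)
    (hvs : G.Adj v s) : (G.induce (insert v S)).Connected := by
  rw [connected_induce_iff_forall_closed] at hS ⊢
  obtain ⟨-, hcon⟩ := hS
  refine ⟨⟨v, by simp⟩, fun X hX ⟨x, hx⟩ hcl => ?_⟩
  have hne : (X ∩ S).Nonempty := by
    by_cases hxS : x ∈ S
    · exact ⟨x, hx, hxS⟩
    · obtain rfl : x = v := (hX hx).resolve_right hxS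
      exact ⟨s, hcl x hx s (Or.inr hs) hvs, hs⟩
  have hSX : S ⊆ X := fun a ha => (hcon (X ∩ S) Set.inter_subset_right hne
    (fun a ha b hb hab => ⟨hcl a ha.1 b (Or.inr hb) hab, hb⟩) ha).1
  exact Set.insert_subset (hcl s (hSX hs) v (Or.inl rfl) hvs.symm) hSX

end Connectivity

section Main

variable {V : Type*} [Fintype V] {G : SimpleGraph V}

theorem le_ncard_neighbors_of_degLeTwo [DecidableRel G.Adj] {W : Set V} {v : (Wᶜ : Set V)}
    (hv : DegLeTwo (G.induce (Wᶜ : Set V)) v) :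
    G.minDegree ≤ {w | w ∈ W ∧ G.Adj v w}.ncard + 2 := by
  obtain ⟨a, b, hab⟩ := hv
  have hsub : G.neighborSet v ⊆ {w | w ∈ W ∧ G.Adj v w} ∪ {a.1, b.1} := by
    intro w hw
    by_cases hwW : w ∈ W
    · exact Or.inl ⟨hwW, hw⟩
    · right
      rcases hab ⟨w, hwW⟩ hw with h | h
      · exact Or.inl (congrArg Subtype.val h)
      · exact Or.inr (congrArg Subtype.val h)
  have h1 := Set.ncard_le_ncard hsub (Set.toFinite _)
  have h2 := Set.ncard_union_le {w | w ∈ W ∧ G.Adj v w} {a.1, b.1}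
  have h3 := Set.ncard_insert_le a.1 {b.1}
  rw [Set.ncard_singleton] at h3
  have h4 := G.minDegree_le_degree v
  have h5 : (G.neighborSet v).ncard = G.degree v := by
    rw [Set.ncard_eq_toFinset_card', Set.toFinset_card, card_neighborSet_eq_degree]
  omega

theorem exists_isFragment_of_not_contractibleSet {W : Set V} (hWcon : (G.induce W).Connected)
    (hcard : W.ncard + 4 ≤ Fintype.card V) {v : (Wᶜ : Set V)} {w : V} (hw : w ∈ W)
    (hvw : G.Adj v w) (hnot : ¬ ContractibleSet G (insert v.1 W)) :
    ∃ z Y, IsFragment (G.induce (Wᶜ : Set V)) {v, z} Y := by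
  by_contra! hno
  refine hnot ⟨connected_induce_insert hWcon hw hvw, nConnected_two_induce ?_ ?_⟩
  · have h1 := Set.ncard_insert_le v.1 W
    have h2 := Set.ncard_add_ncard_compl (insert v.1 W)
    rw [Nat.card_eq_fintype_card] at h2
    omega
  · intro S X hS hX hne hcl b hb
    by_contra hbX
    obtain ⟨z, hz⟩ : ∃ z : (Wᶜ : Set V), ∀ a : (Wᶜ : Set V), a ≠ v → (a.1 ∈ S ↔ a = z) := by
      by_cases hs : ∃ a : (Wᶜ : Set V), a ≠ v ∧ a.1 ∈ S
      · obtain ⟨z, hzv, hzS⟩ := hs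
        refine ⟨z, fun a _ => ⟨fun haS => Subtype.ext (hS haS hzS), ?_⟩⟩
        rintro rfl
        exact hzS
      · push Not at hs
        exact ⟨v, fun a hav => ⟨fun h => absurd h (hs a hav), fun h => absurd h hav⟩⟩
    have hmem : ∀ a : (Wᶜ : Set V), a ≠ v → a ≠ z → a.1 ∈ (insert v.1 W)ᶜ \ S := by
      intro a hav haz
      refine ⟨?_, fun h => haz ((hz a hav).1 h)⟩
      rintro (h | h)
      · exact hav (Subtype.ext h)
      · exact a.2 h
    have hmem' : ∀ a ∈ (insert v.1 W)ᶜ \ S, ∃ h : a ∈ (Wᶜ : Set V),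
        (⟨a, h⟩ : (Wᶜ : Set V)) ∉ ({v, z} : Set _) := by
      intro a ha
      have haW : a ∈ (Wᶜ : Set V) := fun h => ha.1 (Or.inr h)
      have hav : (⟨a, haW⟩ : (Wᶜ : Set V)) ≠ v := by
        rintro rfl
        exact ha.1 (Or.inl rfl)
      refine ⟨haW, ?_⟩
      rintro (h | h)
      · exact hav h
      · exact ha.2 ((hz _ hav).2 h)
    obtain ⟨x, hx⟩ := hne
    obtain ⟨hxW, -⟩ := hmem' x (hX hx)
    obtain ⟨hbW, hbS⟩ := hmem' b hb
    refine hno z (Subtype.val ⁻¹' X) ⟨⟨⟨x, hxW⟩, hx⟩, ⟨⟨b, hbW⟩, hbX, hbS⟩, ?_, ?_⟩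
    · exact fun a ha => (hmem' a (hX ha)).2
    · intro a ha c hac
      by_cases hc : c = v ∨ c = z
      · exact Or.inr hc
      · push Not at hc
        exact Or.inl (hcl a ha c (hmem c hc.1 hc.2) hac)

theorem isCritical_induce_compl [DecidableRel G.Adj] {W : Set V} (hG : NConnected G 3) (hW : ContractibleSet G W)
    (hcard : W.ncard + 4 ≤ Fintype.card V) (hδ : 3 ≤ G.minDegree)
    (hnot : ∀ v, ¬ (v ∉ W ∧ ContractibleSet G (insert v W))) :
    IsCritical (G.induce (Wᶜ : Set V)) {v | ∃ w ∈ W, G.Adj v w} where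
  two_conn S X hS := hW.2.not_isFragment (by
    have := Set.ncard_le_one_iff_subsingleton.2 hS
    omega)
  meets := by
    rintro x y X ⟨⟨a, ha⟩, ⟨r, hrX, hrS⟩, hd, hN⟩
    by_contra! hno
    refine hG.not_isFragment (S := {x.1, y.1}) (X := Subtype.val '' X)
      ((Set.ncard_insert_le _ _).trans_lt (by rw [Set.ncard_singleton]; norm_num))
      ⟨⟨a.1, a, ha, rfl⟩, ⟨r.1, ?_, ?_⟩, ?_, ?_⟩
    · rintro ⟨b, hb, h⟩
      exact hrX (Subtype.ext h ▸ hb)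
    · rintro (h | h)
      · exact hrS (Or.inl (Subtype.ext h))
      · exact hrS (Or.inr (Subtype.ext h))
    · rintro _ ⟨b, hb, rfl⟩ (h | h)
      · exact hd b hb (Or.inl (Subtype.ext h))
      · exact hd b hb (Or.inr (Subtype.ext h))
    · rintro _ ⟨b, hb, rfl⟩ d hbd
      have hdW : d ∈ (Wᶜ : Set V) := fun h => hno b hb ⟨d, h, hbd⟩
      rcases hN b hb ⟨d, hdW⟩ hbd with h | h | h
      · exact Or.inl ⟨_, h, rfl⟩
      · exact Or.inr (Or.inl (congrArg Subtype.val h))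
      · exact Or.inr (Or.inr (congrArg Subtype.val h))
  critical := by
    rintro v ⟨w, hw, hvw⟩
    exact exists_isFragment_of_not_contractibleSet hW.1 hcard hw hvw
      fun h => hnot v.1 ⟨v.2, h⟩
  degLeTwo_mem v hv := by
    have h1 := le_ncard_neighbors_of_degLeTwo hv
    obtain ⟨w, hw⟩ := (Set.ncard_pos (Set.toFinite {w | w ∈ W ∧ G.Adj v w})).1 (by omega)
    exact ⟨w, hw⟩
  nonempty := by
    by_contra! hno
    have hWne : W.Nonempty := Set.nonempty_coe_sort.1 hW.1.nonempty
    obtain ⟨r, hr⟩ : ∃ r, r ∉ W := by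
      by_contra! hall
      rw [Set.eq_univ_of_forall hall, Set.ncard_univ, Nat.card_eq_fintype_card] at hcard
      omega
    refine hG.not_isFragment (S := ∅) (X := W) (by simp) ⟨hWne, ⟨r, hr, by simp⟩, by simp, ?_⟩
    intro a ha b hab
    by_contra hb
    have hbW : b ∉ W := fun h => hb (Or.inl h)
    exact Set.notMem_empty (⟨b, hbW⟩ : (Wᶜ : Set V)) (hno ▸ ⟨a, ha, hab.symm⟩)
  card := by
    have h2 := Set.ncard_add_ncard_compl W
    rw [Nat.card_eq_fintype_card] at h2
    have : Nat.card (Wᶜ : Set V) = (Wᶜ : Set V).ncard := rfl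
    omega

end Main

/-- Main lemma: if `k ≥ 3c + 5`, `G` is `3`-connected with a `(k−1)`-contractible set,
`|V(G)| ≥ k + 3` and `δ(G) ≥ k − c`, then `G` has a `k`-contractible set. -/
theorem stmt_1 {V : Type*} [Fintype V] (G : SimpleGraph V) [DecidableRel G.Adj]
    (k c : ℕ) (hkc : 3 * c + 5 ≤ k) (hG : NConnected G 3)
    (hW : ∃ W : Set V, W.ncard = k - 1 ∧ ContractibleSet G W)
    (hv : k + 3 ≤ Fintype.card V)
    (hδ : k - c ≤ G.minDegree) :
    ∃ W : Set V, W.ncard = k ∧ ContractibleSet G W := by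
  obtain ⟨W, hWk, hW⟩ := hW
  by_cases hins : ∃ v, v ∉ W ∧ ContractibleSet G (insert v W)
  · obtain ⟨v, hv, h⟩ := hins
    exact ⟨_, by rw [Set.ncard_insert_of_notMem hv]; omega, h⟩
  push Not at hins
  have hA := isCritical_induce_compl hG hW (by omega) (by omega) (fun v h => hins v h.1 h.2)
  obtain ⟨p, q, y, y', hpq, hp, hq, hy, hy', hyy, hyP, hyP', hcon, hsep⟩ := hA.exists_exchange
  replace hpq : G.Adj p.1 q.1 := hpq
  have hdp := le_ncard_neighbors_of_degLeTwo hp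
  have hdy := le_ncard_neighbors_of_degLeTwo hy
  have hdy' := le_ncard_neighbors_of_degLeTwo hy'
  obtain ⟨s, hs, hqs⟩ := hA.degLeTwo_mem q hq
  have hS := connected_induce_insert (connected_induce_insert hW.1 hs hqs)
    (Set.mem_insert q.1 W) hpq
  obtain ⟨T, hT, hrem⟩ := exists_removable hS (Set.mem_insert p.1 _)
  have hTc : T.ncard ≤ c + 1 := by
    have hsub : {v | v ∈ insert p.1 (insert q.1 W) ∧ v ≠ p.1 ∧ ¬ G.Adj p.1 v} ⊆
        W \ {w | w ∈ W ∧ G.Adj p w} := by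
      rintro v ⟨rfl | rfl | hv, hvp, hva⟩
      · exact absurd rfl hvp
      · exact absurd hpq hva
      · exact ⟨hv, fun h => hva h.2⟩
    have h1 := Set.ncard_le_ncard hsub (Set.toFinite _)
    have h2 := Set.ncard_sdiff (s := {w | w ∈ W ∧ G.Adj p w}) (t := W) (fun w h => h.1)
    omega
  obtain ⟨w, ⟨⟨hwW, hyw⟩, -, hyw'⟩, hwT⟩ : ∃ w ∈ {w | w ∈ W ∧ G.Adj y w} ∩
      {w | w ∈ W ∧ G.Adj y' w}, w ∉ T := by
    refine Set.exists_mem_notMem_of_ncard_lt_ncard ?_ (Set.toFinite _)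
    have h1 := Set.ncard_union_add_ncard_inter {w | w ∈ W ∧ G.Adj y w} {w | w ∈ W ∧ G.Adj y' w}
    have h2 : ({w | w ∈ W ∧ G.Adj y w} ∪ {w | w ∈ W ∧ G.Adj y' w}).ncard ≤ W.ncard :=
      Set.ncard_le_ncard (by rintro w (h | h) <;> exact h.1) (Set.toFinite _)
    omega
  have hwp : w ≠ p.1 := fun h => p.2 (h ▸ hwW)
  have hwq : w ≠ q.1 := fun h => q.2 (h ▸ hwW)
  have hcard : (insert p.1 (insert q.1 W) \ {w}).ncard = k := by
    rw [Set.ncard_sdiff_singleton_of_mem (by simp [hwW]), Set.ncard_insert_of_notMem,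
      Set.ncard_insert_of_notMem q.2]
    · omega
    · rintro (h | h)
      · exact hpq.ne h
      · exact p.2 h
  refine ⟨_, hcard, hrem w hwp hwT, nConnected_two_induce ?_ ?_⟩
  · have h2 := Set.ncard_add_ncard_compl (insert p.1 (insert q.1 W) \ {w})
    rw [Nat.card_eq_fintype_card] at h2
    omega
  have hmem : ∀ a, a ∈ (insert p.1 (insert q.1 W) \ {w})ᶜ ↔
      a = w ∨ (a ∉ W ∧ a ≠ p.1 ∧ a ≠ q.1) := by
    intro a
    simp only [Set.mem_compl_iff, Set.mem_sdiff, Set.mem_insert_iff, Set.mem_singleton_iff]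
    tauto
  have key : ∀ S X : Set V, S.Subsingleton → X ⊆ (insert p.1 (insert q.1 W) \ {w})ᶜ \ S →
      X.Nonempty → (∀ a ∈ X, ∀ b ∈ (insert p.1 (insert q.1 W) \ {w})ᶜ \ S, G.Adj a b → b ∈ X) →
      w ∉ X → (insert p.1 (insert q.1 W) \ {w})ᶜ \ S ⊆ X := by
    intro S X hS hX ⟨x, hx⟩ hcl hwX b hb
    have hXmem : ∀ a ∈ X, a ∉ W ∧ a ≠ p.1 ∧ a ≠ q.1 := fun a ha =>
      ((hmem a).1 (hX ha).1).resolve_left fun h => hwX (h ▸ ha)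
    have hy_notMem : w ∉ S → y.1 ∉ X := fun hwS h =>
      hwX (hcl y.1 h w ⟨(hmem w).2 (Or.inl rfl), hwS⟩ hyw)
    have hy'_notMem : w ∉ S → y'.1 ∉ X := fun hwS h =>
      hwX (hcl y'.1 h w ⟨(hmem w).2 (Or.inl rfl), hwS⟩ hyw')
    have hxZ : (Subtype.val ⁻¹' X : Set (Wᶜ : Set V)).Nonempty := ⟨⟨x, (hXmem x hx).1⟩, hx⟩
    have hpZ : p ∉ (Subtype.val ⁻¹' X : Set (Wᶜ : Set V)) := fun h => (hXmem _ h).2.1 rfl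
    have hqZ : q ∉ (Subtype.val ⁻¹' X : Set (Wᶜ : Set V)) := fun h => (hXmem _ h).2.2 rfl
    by_cases ht : ∃ t : (Wᶜ : Set V), t ≠ p ∧ t ≠ q ∧ t.1 ∈ S
    · obtain ⟨t, htp, htq, htS⟩ := ht
      have hwS : w ∉ S := fun h => t.2 (hS h htS ▸ hwW)
      exfalso
      refine (hsep t _ hxZ htp htq (fun h => (hX h).2 htS) hpZ hqZ ?_).elim
        (hy_notMem hwS) (hy'_notMem hwS)
      intro a ha d had
      by_contra! hd
      exact hd.1 (hcl a ha d ⟨(hmem d).2 (Or.inr ⟨d.2, fun h => hd.2.2.1 (Subtype.ext h),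
        fun h => hd.2.2.2 (Subtype.ext h)⟩), fun h => hd.2.1 (Subtype.ext (hS h htS))⟩ had)
    · push Not at ht
      have hall := hcon _ hxZ hpZ hqZ (fun a ha d had => by
        by_contra! hd
        exact hd.1 (hcl a ha d ⟨(hmem d).2 (Or.inr ⟨d.2, fun h => hd.2.1 (Subtype.ext h),
          fun h => hd.2.2 (Subtype.ext h)⟩), ht d hd.2.1 hd.2.2⟩ had))
      have hwS : w ∈ S := by
        by_contra hwS
        exact hy_notMem hwS (hall y hyP.1 hyP.2)
      obtain ⟨hbW, hbp, hbq⟩ := ((hmem b).1 hb.1).resolve_left fun h => hb.2 (h ▸ hwS)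
      exact hall ⟨b, hbW⟩ (fun h => hbp (congrArg Subtype.val h))
        fun h => hbq (congrArg Subtype.val h)
  intro S X hS hX hne hcl
  by_cases hwX : w ∈ X
  · intro b hb
    by_contra hbX
    obtain ⟨x, hx⟩ := hne
    refine (key S (((insert p.1 (insert q.1 W) \ {w})ᶜ \ S) \ X) hS Set.sdiff_subset
      ⟨b, hb, hbX⟩ ?_ (fun h => h.2 hwX) (hX hx)).2 hx
    exact fun a ha d hd had => ⟨hd, fun hdX => ha.2 (hcl d hdX a ha.1 had.symm)⟩
  · exact key S X hS hX hne hcl hwX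
end

section
/- Let G be a finite 3-connected simple graph with |V(G)| ≥ k + 3 which has a (k − 1)-contractible set W, for some integer k ≥ 2. Suppose there are four distinct vertices v₁, v₂, v₃, v₄ ∈ V(G) \ W such that: (1) v₁v₂ is an edge of G and each vᵢ (i = 1,2,3,4) has degree 2 in the graph G − W; (2) for every vertex x ∈ W adjacent in G to both v₃ and v₄, the graph G − (W \ {x}) − {v₁, v₂} is 2-connected; (3) |N_G(v₃) ∩ N_G(v₄) ∩ W| > |W \ N_G({v₁, v₂})|, where N_G({v₁,v₂}) is the set of vertices adjacent in G to v₁ or to v₂. Then G has a k-contractible set. -/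
open SimpleGraph

/-- In a connected induced subgraph, a nonempty set of vertices closed under taking neighbours
contains everything. -/
theorem subset_of_closed_of_connected_induce {V : Type*} {G : SimpleGraph V} {W C : Set V}
    (hW : (G.induce W).Connected) (hCW : C ⊆ W) (hne : C.Nonempty)
    (hC : ∀ c ∈ C, ∀ w ∈ W, G.Adj c w → w ∈ C) : W ⊆ C := by
  intro w hw
  obtain ⟨c, hc⟩ := hne
  have h := (reachable_iff_reflTransGen _ _).1 (hW.preconnected ⟨c, hCW hc⟩ ⟨w, hw⟩)
  suffices H : ∀ z : W, Relation.ReflTransGen (G.induce W).Adj ⟨c, hCW hc⟩ z → (z : V) ∈ C from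
    H _ h
  intro z hz
  induction hz with
  | refl => exact hc
  | tail _ hadj ih => exact hC _ ih _ (Subtype.prop _) hadj

/-- If replacing `x` by the edge `ab` disconnects `G[W]`, some nonempty part of `W` avoiding
the neighbours of `a` and `b` is attached to the rest of `W` only through `x`. -/
theorem exists_closed_of_not_connected {V : Type*} {G : SimpleGraph V} {W : Set V} {x a b : V}
    (hab : G.Adj a b) (h : ¬ (G.induce ((W \ {x}) ∪ {a, b})).Connected) :
    ∃ C : Set V, C.Nonempty ∧ C ⊆ W \ (G.neighborSet a ∪ G.neighborSet b) ∧
      ∀ c ∈ C, ∀ w ∈ W, G.Adj c w → w ∈ C ∨ w = x := by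
  set S : Set V := (W \ {x}) ∪ {a, b} with hS
  have ha : a ∈ S := by simp [hS]
  have hb : b ∈ S := by simp [hS]
  have hrb : (G.induce S).Reachable ⟨a, ha⟩ ⟨b, hb⟩ :=
    Adj.reachable (show (G.induce S).Adj ⟨a, ha⟩ ⟨b, hb⟩ from hab)
  have hstep : ∀ {u w : V} (hu : u ∈ S) (hw : w ∈ S), G.Adj u w →
      (G.induce S).Reachable ⟨a, ha⟩ ⟨u, hu⟩ → (G.induce S).Reachable ⟨a, ha⟩ ⟨w, hw⟩ :=
    fun {u w} hu hw huw hr =>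
      hr.trans (Adj.reachable (show (G.induce S).Adj ⟨u, hu⟩ ⟨w, hw⟩ from huw))
  have hmem : ∀ c (hc : c ∈ S), ¬ (G.induce S).Reachable ⟨a, ha⟩ ⟨c, hc⟩ →
      c ∈ W := by
    intro c hc hn
    rcases hc with hc | rfl | rfl
    · exact hc.1
    · exact absurd (Reachable.refl _) hn
    · exact absurd hrb hn
  refine ⟨{c | ∃ hc : c ∈ S, ¬ (G.induce S).Reachable ⟨a, ha⟩ ⟨c, hc⟩}, ?_, ?_, ?_⟩
  · by_contra hemp
    refine h ((connected_iff_exists_forall_reachable _).2 ⟨⟨a, ha⟩, fun w => ?_⟩)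
    by_contra hw
    exact hemp ⟨w, w.2, hw⟩
  · rintro c ⟨hc, hn⟩
    refine ⟨hmem c hc hn, ?_⟩
    rintro (hac | hbc)
    · exact hn (hstep ha hc hac (Reachable.refl _))
    · exact hn (hstep hb hc hbc hrb)
  · rintro c ⟨hc, hn⟩ w hw hcw
    by_cases hwx : w = x
    · exact Or.inr hwx
    · have hwS : w ∈ S := Or.inl ⟨hw, hwx⟩
      exact Or.inl ⟨hwS, fun hr => hn (hstep hwS hc hcw.symm hr)⟩

/-- In a connected `G[W]` with a vertex outside `U`, at most `|U|` vertices separate a nonempty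
subset of `U` from the rest of `W`. -/
theorem ncard_le_of_forall_exists_closed {V : Type*} [Finite V] {G : SimpleGraph V}
    {W U X : Set V} (hW : (G.induce W).Connected) (hU : ¬ W ⊆ U) (hUW : U ⊆ W) (hXW : X ⊆ W)
    (h : ∀ x ∈ X, ∃ C : Set V, C.Nonempty ∧ C ⊆ U ∧
      ∀ c ∈ C, ∀ w ∈ W, G.Adj c w → w ∈ C ∨ w = x) :
    X.ncard ≤ U.ncard := by
  have h' : ∀ x : V, ∃ (C : Set V) (u : V), x ∈ X → C ⊆ U ∧ u ∈ C ∧ G.Adj u x ∧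
      ∀ c ∈ C, ∀ w ∈ W, G.Adj c w → w ∈ C ∨ w = x := by
    intro x
    by_cases hx : x ∈ X
    · obtain ⟨C, hne, hCU, hcl⟩ := h x hx
      suffices H : ∃ u ∈ C, G.Adj u x by
        obtain ⟨u, hu, hux⟩ := H
        exact ⟨C, u, fun _ => ⟨hCU, hu, hux, hcl⟩⟩
      by_contra! hno
      refine hU ((subset_of_closed_of_connected_induce hW (hCU.trans hUW) hne ?_).trans hCU)
      intro c hc w hw hcw
      rcases hcl c hc w hw hcw with hwC | rfl
      · exact hwC
      · exact absurd hcw (hno c hc)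
    · exact ⟨∅, x, fun hx' => absurd hx' hx⟩
  choose C f hf using h'
  refine Set.ncard_le_ncard_of_injOn f (fun x hx => (hf x hx).1 (hf x hx).2.1) ?_ U.toFinite
  intro x hx y hy hxy
  by_contra hne
  obtain ⟨hxU, hxC, hxadj, hxcl⟩ := hf x hx
  obtain ⟨hyU, hyC, hyadj, hycl⟩ := hf y hy
  have hyx : y ∈ C x :=
    (hxcl _ hxC y (hXW hy) (hxy ▸ hyadj)).resolve_right (fun e => hne e.symm)
  have hxy' : x ∈ C y := (hycl _ hyC x (hXW hx) (hxy ▸ hxadj)).resolve_right hne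
  refine hU ((subset_of_closed_of_connected_induce (C := C x ∪ C y) hW
    ((Set.union_subset hxU hyU).trans hUW) ⟨_, Or.inl hxC⟩ ?_).trans (Set.union_subset hxU hyU))
  rintro c (hc | hc) w hw hcw
  · rcases hxcl c hc w hw hcw with hwC | rfl
    · exact Or.inl hwC
    · exact Or.inr hxy'
  · rcases hycl c hc w hw hcw with hwC | rfl
    · exact Or.inr hwC
    · exact Or.inl hyx

/-- Lemma 4 of the paper. -/
theorem stmt_2 {V : Type*} [Fintype V] (G : SimpleGraph V)
    (k : ℕ) (hk : 2 ≤ k) (hG : NConnected G 3) (hv : k + 3 ≤ Fintype.card V)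
    (W : Set V) (hWcard : W.ncard = k - 1) (hWc : ContractibleSet G W)
    (v₁ v₂ v₃ v₄ : V)
    (hnodup : [v₁, v₂, v₃, v₄].Nodup)
    (hnotW : v₁ ∉ W ∧ v₂ ∉ W ∧ v₃ ∉ W ∧ v₄ ∉ W)
    (h1a : G.Adj v₁ v₂)
    (h1b : ∀ v ∈ [v₁, v₂, v₃, v₄], (G.neighborSet v \ W).ncard = 2)
    (h2 : ∀ x ∈ W, G.Adj x v₃ → G.Adj x v₄ →
      NConnected (G.induce (((W \ {x}) ∪ {v₁, v₂})ᶜ : Set V)) 2)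
    (h3 : (W \ (G.neighborSet v₁ ∪ G.neighborSet v₂)).ncard
        < (G.neighborSet v₃ ∩ G.neighborSet v₄ ∩ W).ncard) :
    ∃ W' : Set V, W'.ncard = k ∧ ContractibleSet G W' := by
  by_contra hno
  refine h3.not_ge (ncard_le_of_forall_exists_closed hWc.1 ?_ Set.sdiff_subset
    Set.inter_subset_right ?_)
  · intro hWU
    exact (Set.ncard_le_ncard (Set.inter_subset_right.trans hWU)).not_gt h3
  · rintro x ⟨⟨hx3, hx4⟩, hxW⟩
    refine exists_closed_of_not_connected h1a fun hconn => hno ⟨_, ?_, hconn,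
      h2 x hxW hx3.symm hx4.symm⟩
    have hdisj : Disjoint (W \ {x}) {v₁, v₂} := by
      rw [Set.disjoint_right]
      rintro z (rfl | rfl) hz
      · exact hnotW.1 hz.1
      · exact hnotW.2.1 hz.1
    rw [Set.ncard_union_eq hdisj, Set.ncard_sdiff_singleton_of_mem hxW, Set.ncard_pair h1a.ne,
      hWcard]
    have hpos : 0 < W.ncard := (Set.ncard_pos).2 ⟨x, hxW⟩
    omega
end

section
/- Let k be an integer and c a non-negative integer with k ≥ 3c + 5. Let G be a finite 3-connected simple graph with |V(G)| ≥ k + 3 and minimum degree δ(G) ≥ k − c, and let W be a (k − 1)-contractible set of G such that the graph G − W is a simple cycle (necessarily on at least 4 vertices). Then G has a k-contractible set. -/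
open SimpleGraph

/-- `G[Y]` is connected iff `Y` is nonempty and no nonempty proper subset of `Y` is closed under
adjacency inside `Y`. -/
lemma connected_induce_iff_closed {V : Type*} {G : SimpleGraph V} {Y : Set V} :
    (G.induce Y).Connected ↔ Y.Nonempty ∧ ∀ Z ⊆ Y, Z.Nonempty →
      (∀ x ∈ Z, ∀ y ∈ Y, G.Adj x y → y ∈ Z) → Y ⊆ Z := by
  constructor
  · intro h
    refine ⟨Set.nonempty_coe_sort.1 h.nonempty, fun Z hZ ⟨z, hz⟩ hcl y hy => ?_⟩
    obtain ⟨p⟩ := h.preconnected ⟨z, hZ hz⟩ ⟨y, hy⟩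
    have key : ∀ a b : Y, (G.induce Y).Walk a b → a.1 ∈ Z → b.1 ∈ Z := by
      intro a b p
      induction p with
      | nil => exact id
      | cons hadj _ ih => exact fun ha => ih (hcl _ ha _ (Subtype.property _) hadj)
    exact key _ _ p hz
  · rintro ⟨⟨x, hx⟩, h⟩
    rw [connected_iff_exists_forall_reachable]
    refine ⟨⟨x, hx⟩, fun ⟨y, hy⟩ => ?_⟩
    have := h {y | ∃ hy : y ∈ Y, (G.induce Y).Reachable ⟨x, hx⟩ ⟨y, hy⟩} (fun y hy => hy.1)
      ⟨x, hx, Reachable.refl _⟩ (fun a ⟨ha, hxa⟩ b hb hab =>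
        ⟨hb, hxa.trans (Adj.reachable (G := G.induce Y) (u := ⟨a, ha⟩) (v := ⟨b, hb⟩) hab)⟩) hy
    exact this.2

lemma connected_induce_union_of_adj {V : Type*} {G : SimpleGraph V} {A B : Set V}
    (hA : (G.induce A).Connected) (hB : (G.induce B).Connected)
    {a b : V} (ha : a ∈ A) (hb : b ∈ B) (hab : G.Adj a b) : (G.induce (A ∪ B)).Connected := by
  have h := induce_union_connected hA.preconnected
    (induce_pair_connected_of_adj hab).preconnected ⟨a, ha, by simp⟩
  have h' := induce_union_connected h.preconnected hB.preconnected ⟨b, by simp, hb⟩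
  have e : A ∪ {a, b} ∪ B = A ∪ B := by
    ext x
    simp only [Set.mem_union, Set.mem_insert_iff, Set.mem_singleton_iff]
    grind
  rwa [e] at h'

lemma connected_induce_singleton {V : Type*} {G : SimpleGraph V} (a : V) :
    (G.induce {a}).Connected := by
  rw [connected_induce_iff_closed]
  refine ⟨⟨a, rfl⟩, ?_⟩
  rintro Z hZ ⟨z, hz⟩ - _ rfl
  exact hZ hz ▸ hz

/-- Joining connected pieces to a connected hub gives a connected set. -/
lemma connected_induce_union_pieces {V : Type*} {G : SimpleGraph V} {I N : Set V} {K : V → Set V}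
    (hI : (G.induce I).Connected) (hK : ∀ z ∈ N, z ∈ K z ∧ K z ⊆ N ∧ (G.induce (K z)).Connected ∧
      ∃ y ∈ K z, ∃ x ∈ I, G.Adj y x) : (G.induce (I ∪ N)).Connected := by
  obtain ⟨u, hu⟩ := Set.nonempty_coe_sort.1 hI.nonempty
  refine induce_connected_of_patches u (Or.inl hu) fun {v} hv => ?_
  rcases hv with hv | hv
  · exact ⟨I, Set.subset_union_left, hu, hv, hI.preconnected _ _⟩
  · obtain ⟨h1, h2, h3, y, hy, x, hx, hyx⟩ := hK v hv
    exact ⟨I ∪ K v, Set.union_subset_union_right _ h2, Or.inl hu, Or.inr h1,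
      (connected_induce_union_of_adj hI h3 hx hy hyx.symm).preconnected _ _⟩

lemma connected_induce_of_attach {V : Type*} {G : SimpleGraph V} {A B : Set V}
    (hA : (G.induce A).Connected) (hAB : A ⊆ B)
    (h : ∀ b ∈ B, b ∉ A → ∃ a ∈ A, G.Adj b a) : (G.induce B).Connected := by
  have := connected_induce_union_pieces (K := fun z => {z}) (N := B \ A) hA fun z hz =>
    ⟨rfl, Set.singleton_subset_iff.2 hz, connected_induce_singleton z, z, rfl, h z hz.1 hz.2⟩
  rwa [Set.union_sdiff_cancel hAB] at this

/-- Every cardinality between those of two nested connected sets is attained by a connected set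
in between. -/
lemma exists_connected_between {V : Type*} [Finite V] {G : SimpleGraph V} {A B : Set V}
    (hA : (G.induce A).Connected) (hB : (G.induce B).Connected) (hAB : A ⊆ B) {m : ℕ}
    (hm : A.ncard ≤ m) (hmB : m ≤ B.ncard) :
    ∃ Y, A ⊆ Y ∧ Y ⊆ B ∧ Y.ncard = m ∧ (G.induce Y).Connected := by
  induction m, hm using Nat.le_induction with
  | base => exact ⟨A, subset_rfl, hAB, rfl, hA⟩
  | succ m hm ih =>
    obtain ⟨Y, hAY, hYB, hYm, hY⟩ := ih (by omega)
    have hne : ¬ B ⊆ Y := fun h => by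
      have := Set.ncard_le_ncard h
      omega
    have hex : ∃ x ∈ Y, ∃ y ∈ B, G.Adj x y ∧ y ∉ Y := by
      by_contra! hcon
      exact hne ((connected_induce_iff_closed.1 hB).2 Y hYB
        (Set.nonempty_coe_sort.1 hY.nonempty) hcon)
    obtain ⟨x, hx, y, hy, hxy, hyY⟩ := hex
    refine ⟨insert y Y, hAY.trans (Set.subset_insert _ _), Set.insert_subset hy hYB, ?_, ?_⟩
    · rw [Set.ncard_insert_of_notMem hyY, hYm]
    · refine connected_induce_of_attach hY (Set.subset_insert _ _) fun b hb hbY => ?_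
      obtain rfl : b = y := hb.resolve_right hbY
      exact ⟨x, hx, hxy.symm⟩

/-- The connected components of an induced subgraph, as a map from vertices to sets. -/
lemma exists_components {V : Type*} (G : SimpleGraph V) (R : Set V) :
    ∃ K : V → Set V, (∀ z ∈ R, z ∈ K z) ∧ (∀ z, K z ⊆ R) ∧ (∀ z, ∀ y ∈ K z, K y = K z) ∧
      (∀ z ∈ R, (G.induce (K z)).Connected) ∧
      (∀ z, ∀ x ∈ K z, ∀ y ∈ R, G.Adj x y → y ∈ K z) := by
  let r : V → V → Prop := fun z y => ∃ Y ⊆ R, z ∈ Y ∧ y ∈ Y ∧ (G.induce Y).Connected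
  have symm : ∀ {x y}, r x y → r y x := fun ⟨Y, h1, h2, h3, h4⟩ => ⟨Y, h1, h3, h2, h4⟩
  have trans : ∀ {x y z}, r x y → r y z → r x z := fun ⟨Y, h1, h2, h3, h4⟩ ⟨Y', h1', h2', h3', h4'⟩ =>
    ⟨Y ∪ Y', Set.union_subset h1 h1', Or.inl h2, Or.inr h3',
      induce_union_connected h4.preconnected h4'.preconnected ⟨_, h3, h2'⟩⟩
  have refl : ∀ z ∈ R, r z z := fun z hz =>
    ⟨{z}, Set.singleton_subset_iff.2 hz, rfl, rfl, connected_induce_singleton z⟩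
  refine ⟨fun z => {y | r z y}, refl, fun z y ⟨Y, h1, _, h3, _⟩ => h1 h3, fun z y hy => ?_,
    fun z hz => ?_, fun z x hx y hy hxy => ?_⟩
  · ext t
    exact ⟨fun h => trans hy h, fun h => trans (symm hy) h⟩
  · refine induce_connected_of_patches z (refl z hz) fun {v} hv => ?_
    obtain ⟨Y, h1, h2, h3, h4⟩ := hv
    exact ⟨Y, fun t ht => ⟨Y, h1, h2, ht, h4⟩, h2, h3, h4.preconnected _ _⟩
  · refine trans hx ⟨{x, y}, ?_, by simp, by simp, induce_pair_connected_of_adj hxy⟩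
    obtain ⟨Y, h1, _, h3, _⟩ := hx
    exact Set.insert_subset (h1 h3) (Set.singleton_subset_iff.2 hy)

lemma connected_induce_image_Icc {V : Type*} {G : SimpleGraph V} {q : ℕ → V}
    (hq : ∀ j, G.Adj (q j) (q (j + 1))) {i j : ℕ} (hij : i ≤ j) :
    (G.induce (q '' Set.Icc i j)).Connected := by
  induction j, hij using Nat.le_induction with
  | base =>
    rw [Set.Icc_self, Set.image_singleton]
    exact connected_induce_singleton (q i)
  | succ j hj ih =>
    have := connected_induce_union_of_adj ih (connected_induce_singleton (q (j + 1)))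
      ⟨j, ⟨hj, le_rfl⟩, rfl⟩ rfl (hq j)
    have e : Set.Icc i j ∪ {j + 1} = Set.Icc i (j + 1) := by
      ext t
      simp only [Set.mem_Icc, Set.mem_union, Set.mem_singleton_iff]
      omega
    rwa [← Set.image_singleton (f := q), ← Set.image_union, e] at this

lemma nconnected_two_induce {V : Type*} [Finite V] {G : SimpleGraph V} {Q : Set V}
    (hcard : 2 < Q.ncard) (hQ : Qᶜ.Nonempty) (h : ∀ v, (G.induce (Q \ {v})).Connected) :
    NConnected (G.induce Q) 2 := by
  refine ⟨hcard, fun S hS => ?_⟩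
  have hv : ∃ v, Q \ {v} = Subtype.val '' Sᶜ := by
    obtain ⟨v, hv⟩ := hQ
    rcases (Set.ncard_le_one_iff_eq).1 (by omega : S.ncard ≤ 1) with rfl | ⟨a, rfl⟩
    · refine ⟨v, ?_⟩
      simp [Set.sdiff_singleton_eq_self hv]
    · refine ⟨a, ?_⟩
      ext t
      simp
  obtain ⟨v, hv⟩ := hv
  have hc := h v
  rw [hv] at hc
  let f : (G.induce Q).induce Sᶜ ≃g G.induce (Subtype.val '' Sᶜ) :=
    { toEquiv := Equiv.Set.image Subtype.val Sᶜ Subtype.val_injective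
      map_rel_iff' := Iff.rfl }
  exact f.connected_iff.2 hc

/-- A path together with a set `S` of vertices attached to it, in such a way that the ends of the
path are adjacent to a connected set `T ⊆ S`, stays connected after deleting any vertex. -/
lemma connected_path_union_sdiff {V : Type*} {G : SimpleGraph V} {q : ℕ → V}
    (hq : ∀ j, G.Adj (q j) (q (j + 1))) {m n : ℕ} (hmn : m < n)
    (hinj : Set.InjOn q (Set.Icc m n)) {S T : Set V} (hTS : T ⊆ S)
    (hT : (G.induce T).Connected) (hdisj : ∀ i ∈ Set.Icc m n, q i ∉ S)
    (hm : ∃ t ∈ T, G.Adj (q m) t) (hn : ∃ t ∈ T, G.Adj (q n) t)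
    (h1 : ∀ z ∈ T, ∃ i ∈ Set.Icc m n, G.Adj z (q i))
    (h2 : ∀ z ∈ S, z ∉ T → ∃ i ∈ Set.Icc m n, ∃ j ∈ Set.Icc m n,
      i ≠ j ∧ G.Adj z (q i) ∧ G.Adj z (q j)) (v : V) :
    (G.induce ((q '' Set.Icc m n ∪ S) \ {v})).Connected := by
  by_cases hv : v ∈ q '' Set.Icc m n
  · obtain ⟨j, hj, rfl⟩ := hv
    have hub : (G.induce (T ∪ q '' (Set.Icc m n \ {j}))).Connected := by
      obtain ⟨a, ha, hma⟩ := hm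
      obtain ⟨b, hb, hnb⟩ := hn
      have hleft : (G.induce (T ∪ q '' (Set.Ico m j))).Connected := by
        rcases hj.1.eq_or_lt with rfl | hlt
        · rwa [Set.Ico_self, Set.image_empty, Set.union_empty]
        · have := connected_induce_union_of_adj hT
            (connected_induce_image_Icc (i := m) (j := j - 1) hq (by omega)) ha
            ⟨m, ⟨le_rfl, by omega⟩, rfl⟩ hma.symm
          have e : Set.Icc m (j - 1) = Set.Ico m j := by
            ext t
            simp only [Set.mem_Icc, Set.mem_Ico]
            omega
          rwa [e] at this
      have hsplit : Set.Icc m n \ {j} = Set.Ico m j ∪ Set.Ioc j n := by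
        ext t
        simp only [Set.mem_sdiff, Set.mem_Icc, Set.mem_singleton_iff, Set.mem_union, Set.mem_Ico,
          Set.mem_Ioc]
        have := hj.1
        have := hj.2
        omega
      rw [hsplit, Set.image_union, ← Set.union_assoc]
      rcases hj.2.eq_or_lt with rfl | hlt
      · rwa [Set.Ioc_self, Set.image_empty, Set.union_empty]
      · have := connected_induce_union_of_adj hleft
          (connected_induce_image_Icc (i := j + 1) (j := n) hq (by omega)) (Or.inl hb)
          ⟨n, ⟨by omega, le_rfl⟩, rfl⟩ hnb.symm
        have e : Set.Icc (j + 1) n = Set.Ioc j n := by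
          ext t
          simp only [Set.mem_Icc, Set.mem_Ioc]
          omega
        rwa [e] at this
    refine connected_induce_of_attach hub ?_ ?_
    · rintro x (hx | ⟨i, ⟨hi, hij⟩, rfl⟩)
      · exact ⟨Or.inr (hTS hx), fun h => hdisj j hj (h ▸ hTS hx)⟩
      · exact ⟨Or.inl ⟨i, hi, rfl⟩, fun h => hij (hinj hi hj h)⟩
    · rintro x ⟨⟨i, hi, rfl⟩ | hx, hxv⟩ hxT
      · exact absurd (Or.inr ⟨i, ⟨hi, fun h => hxv (congrArg q h)⟩, rfl⟩) hxT
      · obtain ⟨a, ha, b, hb, hab, hxa, hxb⟩ := h2 x hx fun h => hxT (Or.inl h)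
        by_cases haj : a = j
        · exact ⟨q b, Or.inr ⟨b, ⟨hb, fun h => hab (haj.trans h.symm)⟩, rfl⟩, hxb⟩
        · exact ⟨q a, Or.inr ⟨a, ⟨ha, haj⟩, rfl⟩, hxa⟩
  · refine connected_induce_of_attach (connected_induce_image_Icc hq hmn.le) ?_ ?_
    · exact fun x hx => ⟨Or.inl hx, fun h => hv (h ▸ hx)⟩
    · rintro x ⟨hx | hx, -⟩ hxP
      · exact absurd hx hxP
      · by_cases hxT : x ∈ T
        · obtain ⟨i, hi, hxi⟩ := h1 x hxT
          exact ⟨q i, ⟨i, hi, rfl⟩, hxi⟩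
        · obtain ⟨i, hi, -, -, -, hxi, -⟩ := h2 x hx hxT
          exact ⟨q i, ⟨i, hi, rfl⟩, hxi⟩

/-- `p` winds periodically around an induced cycle of length `n` with vertex set `C`. -/
structure IsCycleParam {V : Type*} (G : SimpleGraph V) (C : Set V) (n : ℕ) (p : ℕ → V) : Prop where
  eq_iff : ∀ i j, p i = p j ↔ i ≡ j [MOD n]
  range_eq : Set.range p = C
  adj_succ : ∀ j, G.Adj (p j) (p (j + 1))
  of_adj : ∀ i j, G.Adj (p i) (p j) → j ≡ i + 1 [MOD n] ∨ i ≡ j + 1 [MOD n]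

lemma exists_isCycleParam {V : Type*} {G : SimpleGraph V} {C : Set V} {n : ℕ} (hn : 3 ≤ n)
    (φ : G.induce C ≃g cycleGraph n) : ∃ p, IsCycleParam G C n p := by
  have hpos : 0 < n := by omega
  have hsub : ∀ i j : ℕ, ((⟨i % n, Nat.mod_lt _ hpos⟩ - ⟨j % n, Nat.mod_lt _ hpos⟩ : Fin n)).val = 1 ↔
      i ≡ j + 1 [MOD n] := by
    intro i j
    have hj := Nat.mod_lt j hpos
    rw [Fin.sub_def]
    simp only
    have h1 : (n - j % n + i % n) % n = 1 ↔ n - j % n + i % n ≡ 1 [MOD n] := by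
      rw [Nat.ModEq, Nat.mod_eq_of_lt (a := 1) (by omega)]
    rw [h1]
    have h2 : (j + (n - j % n + i % n)) ≡ i [MOD n] := by
      have e : j + (n - j % n + i % n) = (i % n) + n * (j / n + 1) := by
        have := Nat.mod_add_div j n
        rw [mul_add, mul_one]
        omega
      rw [e]
      simp [Nat.ModEq]
    constructor
    · intro h
      exact h2.symm.trans (Nat.ModEq.add_left j h)
    · intro h
      exact Nat.ModEq.add_left_cancel' j (h2.trans h)
  have hadj : ∀ i j : ℕ, G.Adj (φ.symm ⟨i % n, Nat.mod_lt _ hpos⟩).1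
      (φ.symm ⟨j % n, Nat.mod_lt _ hpos⟩).1 ↔ i ≡ j + 1 [MOD n] ∨ j ≡ i + 1 [MOD n] := by
    intro i j
    rw [← hsub i j, ← hsub j i, ← cycleGraph_adj']
    exact φ.symm.map_adj_iff
  refine ⟨fun j => φ.symm ⟨j % n, Nat.mod_lt _ hpos⟩, fun i j => ?_, ?_, fun j => ?_,
    fun i j h => ?_⟩
  · rw [Subtype.val_inj, φ.symm.injective.eq_iff, Fin.mk.injEq, Nat.ModEq]
  · ext v
    constructor
    · rintro ⟨j, rfl⟩
      exact Subtype.property _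
    · intro hv
      refine ⟨φ ⟨v, hv⟩, ?_⟩
      simp [Nat.mod_eq_of_lt (φ ⟨v, hv⟩).isLt]
  · exact (hadj _ _).2 (Or.inr rfl)
  · exact ((hadj _ _).1 h).symm

namespace IsCycleParam

variable {V : Type*} {G : SimpleGraph V} {C : Set V} {n : ℕ} {p : ℕ → V}

lemma mem (h : IsCycleParam G C n p) (j : ℕ) : p j ∈ C := h.range_eq ▸ Set.mem_range_self j

lemma shift (h : IsCycleParam G C n p) (hn : 0 < n) (i : ℕ) :
    IsCycleParam G C n (fun j => p (i + j)) where
  eq_iff a b := (h.eq_iff _ _).trans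
    ⟨fun h => Nat.ModEq.add_left_cancel' i h, fun h => Nat.ModEq.add_left i h⟩
  range_eq := by
    refine Set.Subset.antisymm (Set.range_subset_iff.2 fun j => h.mem _) ?_
    rw [← h.range_eq]
    rintro _ ⟨j, rfl⟩
    refine ⟨j + i * (n - 1), (h.eq_iff _ _).2 ?_⟩
    obtain ⟨m, rfl⟩ := Nat.exists_eq_add_of_lt hn
    have e : i + (j + i * (0 + m + 1 - 1)) = j + i * (0 + m + 1) := by
      simp only [Nat.add_sub_cancel]
      ring
    rw [e]
    simp [Nat.ModEq]
  adj_succ j := h.adj_succ _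
  of_adj a b hab := by
    rcases h.of_adj _ _ hab with h | h
    · exact Or.inl (Nat.ModEq.add_left_cancel' i (by simpa [add_assoc] using h))
    · exact Or.inr (Nat.ModEq.add_left_cancel' i (by simpa [add_assoc] using h))

lemma injOn_Icc (h : IsCycleParam G C n p) {a b : ℕ} (hab : b < a + n) :
    Set.InjOn p (Set.Icc a b) := by
  intro i hi j hj hij
  have := (h.eq_iff i j).1 hij
  rcases le_total i j with hle | hle
  · have hd := (Nat.modEq_iff_dvd' hle).1 this
    have := Nat.eq_zero_of_dvd_of_lt hd (by have := hi.1; have := hj.2; omega)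
    omega
  · have hd := (Nat.modEq_iff_dvd' hle).1 this.symm
    have := Nat.eq_zero_of_dvd_of_lt hd (by have := hj.1; have := hi.2; omega)
    omega

lemma ncard_image_Icc (h : IsCycleParam G C n p) {a b : ℕ} (hab : b < a + n) :
    (p '' Set.Icc a b).ncard = b + 1 - a := by
  rw [(h.injOn_Icc hab).ncard_image, ← Finset.coe_Icc, Set.ncard_coe_finset,
    Nat.card_Icc]

lemma image_Icc_one (h : IsCycleParam G C n p) (hn : 0 < n) : p '' Set.Icc 1 n = C := by
  refine Set.Subset.antisymm (Set.image_subset_iff.2 fun j _ => h.mem j) ?_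
  rw [← h.range_eq]
  rintro _ ⟨j, rfl⟩
  by_cases hj : j % n = 0
  · exact ⟨n, ⟨hn, le_rfl⟩, (h.eq_iff _ _).2 (by simp [Nat.ModEq, hj])⟩
  · exact ⟨j % n, ⟨by omega, (Nat.mod_lt _ hn).le⟩, (h.eq_iff _ _).2 (Nat.mod_modEq _ _)⟩

lemma ncard_eq (h : IsCycleParam G C n p) (hn : 0 < n) : C.ncard = n := by
  rw [← h.image_Icc_one hn, h.ncard_image_Icc (by omega)]
  omega

lemma ncard_adj_le (h : IsCycleParam G C n p) (hn : 0 < n) {v : V} (hv : v ∈ C) :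
    {u ∈ C | G.Adj v u}.ncard ≤ 2 := by
  rw [← h.range_eq] at hv
  obtain ⟨j, rfl⟩ := hv
  have hsub : {u ∈ C | G.Adj (p j) u} ⊆ {p (j + 1), p (j + (n - 1))} := by
    rintro u ⟨hu, hju⟩
    rw [← h.range_eq] at hu
    obtain ⟨i, rfl⟩ := hu
    rcases h.of_adj _ _ hju with e | e
    · exact Or.inl ((h.eq_iff _ _).2 e)
    · refine Or.inr ((h.eq_iff _ _).2 ?_)
      have e' := Nat.ModEq.add_right (n - 1) e
      rw [add_assoc, show 1 + (n - 1) = n by omega] at e'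
      exact (e'.trans (by simp [Nat.ModEq])).symm
  exact (Set.ncard_le_ncard hsub (Set.toFinite _)).trans (by
    simpa using Set.ncard_insert_le (p (j + 1)) {p (j + (n - 1))})

/-- A vertex missing fewer than half of the cycle is adjacent to two cycle vertices at any
prescribed distance. -/
lemma exists_adj_adj (h : IsCycleParam G C n p) [DecidableRel G.Adj] {w : V}
    (hw : 2 * ((Finset.range n).filter fun j => ¬ G.Adj w (p j)).card < n) (d : ℕ) :
    ∃ i, G.Adj w (p i) ∧ G.Adj w (p (i + d)) := by
  by_contra! hcon
  have hper : Function.Periodic (fun j => ¬ G.Adj w (p j)) n := fun j => by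
    have : p (j + n) = p j := (h.eq_iff _ _).2 (by simp [Nat.ModEq])
    simp only [this]
  have h1 : ((Finset.range n).filter fun j => ¬ G.Adj w (p (j + d))).card =
      ((Finset.range n).filter fun j => ¬ G.Adj w (p j)).card := by
    rw [← Nat.count_eq_card_filter_range (fun j => ¬ G.Adj w (p j)),
      ← Nat.filter_Ico_card_eq_of_periodic d n _ hper]
    refine Finset.card_bij (fun j _ => j + d) ?_ ?_ ?_
    · intro j hj
      simp only [Finset.mem_filter, Finset.mem_range, Finset.mem_Ico] at hj ⊢
      exact ⟨by omega, hj.2⟩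
    · intro a _ b _ hab
      exact Nat.add_right_cancel hab
    · intro b hb
      simp only [Finset.mem_filter, Finset.mem_Ico] at hb
      refine ⟨b - d, ?_, by omega⟩
      simp only [Finset.mem_filter, Finset.mem_range]
      rw [Nat.sub_add_cancel hb.1.1]
      exact ⟨by omega, hb.2⟩
  have h2 : Finset.range n ⊆ ((Finset.range n).filter fun j => ¬ G.Adj w (p j)) ∪
      ((Finset.range n).filter fun j => ¬ G.Adj w (p (j + d))) := by
    intro j hj
    by_cases hwj : G.Adj w (p j)
    · exact Finset.mem_union_right _ (Finset.mem_filter.2 ⟨hj, hcon j hwj⟩)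
    · exact Finset.mem_union_left _ (Finset.mem_filter.2 ⟨hj, hwj⟩)
  have h3 := (Finset.card_le_card h2).trans (Finset.card_union_le _ _)
  rw [Finset.card_range, h1] at h3
  omega

/-- If every cycle vertex misses at most `m` vertices of `W` and `2 * m < |W|`, then some vertex
of `W` misses fewer than half of the cycle. -/
lemma exists_two_mul_card_lt [Finite V] (h : IsCycleParam G C n p) [DecidableRel G.Adj]
    (hn : 0 < n) {W : Set V} {m : ℕ} (hm : ∀ v ∈ C, {u ∈ W | ¬ G.Adj v u}.ncard ≤ m)
    (hmW : 2 * m < W.ncard) :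
    ∃ w ∈ W, 2 * ((Finset.range n).filter fun j => ¬ G.Adj w (p j)).card < n := by
  classical
  have : Fintype V := Fintype.ofFinite V
  by_contra! hcon
  have hdc := Finset.sum_card_bipartiteAbove_eq_sum_card_bipartiteBelow
    (s := W.toFinset) (t := Finset.range n) (fun w j => ¬ G.Adj w (p j))
  have h1 : W.ncard * n ≤ 2 * ∑ w ∈ W.toFinset,
      ((Finset.range n).bipartiteAbove (fun w j => ¬ G.Adj w (p j)) w).card := by
    rw [Set.ncard_eq_toFinset_card', Finset.mul_sum, ← smul_eq_mul]
    exact Finset.card_nsmul_le_sum _ _ _ fun w hw => hcon w (Set.mem_toFinset.1 hw)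
  have h2 : ∑ j ∈ Finset.range n,
      (W.toFinset.bipartiteBelow (fun w j => ¬ G.Adj w (p j)) j).card ≤ n * m := by
    have := Finset.sum_le_card_nsmul (Finset.range n)
      (fun j => (W.toFinset.bipartiteBelow (fun w j => ¬ G.Adj w (p j)) j).card) m fun j _ => by
        refine le_trans (le_of_eq ?_) (hm (p j) (h.mem j))
        rw [← Set.ncard_coe_finset]
        congr 1
        ext u
        simp [Finset.bipartiteBelow, G.adj_comm]
    simpa using this
  rw [hdc] at h1
  nlinarith

end IsCycleParam

/-- A cycle vertex has all but a bounded number of vertices of `W` as neighbours. -/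
lemma ncard_not_adj_le {V : Type*} [Fintype V] {G : SimpleGraph V} [DecidableRel G.Adj]
    {W : Set V} {v : V} {d : ℕ} (hd : d ≤ G.minDegree) (h2 : {u ∈ Wᶜ | G.Adj v u}.ncard ≤ 2) :
    {u ∈ W | ¬ G.Adj v u}.ncard + d ≤ W.ncard + 2 := by
  classical
  have h1 : {u ∈ W | ¬ G.Adj v u}.ncard + {u ∈ W | G.Adj v u}.ncard = W.ncard := by
    rw [← Set.ncard_union_eq]
    · congr 1
      ext u
      simp only [Set.mem_union, Set.mem_ofPred_eq]
      tauto
    · rw [Set.disjoint_left]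
      exact fun u hu hu' => hu.2 hu'.2
  have h3 : (G.neighborSet v).ncard = G.degree v := by
    rw [Set.ncard_eq_toFinset_card', ← neighborFinset_def, card_neighborFinset_eq_degree]
  have h4 : G.neighborSet v ⊆ {u ∈ W | G.Adj v u} ∪ {u ∈ Wᶜ | G.Adj v u} := fun u hu => by
    by_cases huW : u ∈ W
    · exact Or.inl ⟨huW, hu⟩
    · exact Or.inr ⟨huW, hu⟩
  have h5 := (Set.ncard_le_ncard h4).trans (Set.ncard_union_le _ _)
  have h6 := G.minDegree_le_degree v
  omega

/-- A vertex `z` of a component `K` of `W \ {w}` has many neighbours outside `W` if `K` is small. -/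
lemma le_ncard_adj_compl {V : Type*} [Fintype V] {G : SimpleGraph V} [DecidableRel G.Adj]
    {W K : Set V} {w z : V} {d : ℕ} (hd : d ≤ G.minDegree) (hz : z ∈ K)
    (hK : ∀ y ∈ W \ {w}, G.Adj z y → y ∈ K) :
    d ≤ K.ncard + {u ∈ Wᶜ | G.Adj z u}.ncard := by
  classical
  have h3 : (G.neighborSet z).ncard = G.degree z := by
    rw [Set.ncard_eq_toFinset_card', ← neighborFinset_def, card_neighborFinset_eq_degree]
  have h4 : G.neighborSet z ⊆ insert w (K \ {z}) ∪ {u ∈ Wᶜ | G.Adj z u} := fun u hu => by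
    by_cases huW : u ∈ W
    · by_cases huw : u = w
      · exact Or.inl (Or.inl huw)
      · exact Or.inl (Or.inr ⟨hK u ⟨huW, huw⟩ hu, (G.ne_of_adj hu).symm⟩)
    · exact Or.inr ⟨huW, hu⟩
  have h5 := (Set.ncard_le_ncard h4).trans (Set.ncard_union_le _ _)
  have h6 := G.minDegree_le_degree z
  have h7 := Set.ncard_insert_le w (K \ {z})
  have h8 := Set.ncard_sdiff_singleton_add_one hz
  omega

/-- Replacing `W` by a set `Y` which takes over the initial arc `q 1, …, q m` of the cycle and
gives back `W \ Y`. -/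
lemma IsCycleParam.contractibleSet {V : Type*} [Finite V] {G : SimpleGraph V} {W Y T : Set V}
    {n m : ℕ} {q : ℕ → V} (h : IsCycleParam G Wᶜ n q) (hm : 1 ≤ m) (hmn : m + 1 < n)
    (hIY : q '' Set.Icc 1 m ⊆ Y) (hYI : Y ⊆ q '' Set.Icc 1 m ∪ W) (hcard : 2 < (Yᶜ).ncard)
    (hY : (G.induce Y).Connected) (hTS : T ⊆ W \ Y) (hT : (G.induce T).Connected)
    (h0 : ∃ t ∈ T, G.Adj (q 0) t) (h1 : ∃ t ∈ T, G.Adj (q (m + 1)) t)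
    (hT1 : ∀ z ∈ T, 1 ≤ {u ∈ Wᶜ \ q '' Set.Icc 1 m | G.Adj z u}.ncard)
    (hT2 : ∀ z ∈ W \ Y, z ∉ T → 2 ≤ {u ∈ Wᶜ \ q '' Set.Icc 1 m | G.Adj z u}.ncard) :
    ContractibleSet G Y := by
  have hn : 0 < n := by omega
  have hwin := h.image_Icc_one hn
  have hinj : Set.InjOn q (Set.Icc 1 n) := h.injOn_Icc (by omega)
  have hsplit : Set.Icc 1 n = Set.Icc 1 m ∪ Set.Icc (m + 1) n := by
    ext t
    simp only [Set.mem_Icc, Set.mem_union]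
    omega
  have hP : Wᶜ \ q '' Set.Icc 1 m = q '' Set.Icc (m + 1) n := by
    rw [← hwin, ← hinj.image_sdiff_subset (by rw [hsplit]; exact Set.subset_union_left)]
    congr 1
    ext t
    simp only [Set.mem_sdiff, Set.mem_Icc]
    omega
  have hcompl : Yᶜ = q '' Set.Icc (m + 1) n ∪ (W \ Y) := by
    rw [← hP]
    ext t
    have := @hIY t
    have := @hYI t
    simp only [Set.mem_union, Set.mem_compl_iff, Set.mem_sdiff] at *
    tauto
  have hqn : q n = q 0 := (h.eq_iff _ _).2 (by simp [Nat.ModEq])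
  refine ⟨hY, nconnected_two_induce hcard ?_ fun v => ?_⟩
  · rw [compl_compl]
    exact Set.nonempty_coe_sort.1 hY.nonempty
  · rw [hcompl]
    refine connected_path_union_sdiff h.adj_succ hmn (h.injOn_Icc (by omega)) hTS hT
      (fun i _ hi => h.mem i hi.1) h1 (by rwa [hqn]) (fun z hz => ?_) (fun z hz hzT => ?_) v
    · obtain ⟨u, hu, hzu⟩ := (Set.ncard_pos (Set.toFinite _)).1 (hT1 z hz)
      rw [hP] at hu
      obtain ⟨i, hi, rfl⟩ := hu
      exact ⟨i, hi, hzu⟩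
    · obtain ⟨u, ⟨hu, hzu⟩, u', ⟨hu', hzb⟩, hne⟩ :=
        (Set.one_lt_ncard (Set.toFinite _)).1 (hT2 z hz hzT)
      rw [hP] at hu hu'
      obtain ⟨i, hi, rfl⟩ := hu
      obtain ⟨j, hj, rfl⟩ := hu'
      exact ⟨i, hi, j, hj, fun e => hne (congrArg q e), hzu, hzb⟩

/-- Case 1 of the main lemma: `G − W` is a simple cycle. -/
theorem stmt_3 {V : Type*} [Fintype V] (G : SimpleGraph V) [DecidableRel G.Adj]
    (k c : ℕ) (hkc : 3 * c + 5 ≤ k) (hG : NConnected G 3)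
    (hv : k + 3 ≤ Fintype.card V) (hδ : k - c ≤ G.minDegree)
    (W : Set V) (hWcard : W.ncard = k - 1) (hWc : ContractibleSet G W)
    (hcyc : ∃ n : ℕ, 3 ≤ n ∧
      Nonempty (G.induce (Wᶜ : Set V) ≃g SimpleGraph.cycleGraph n)) :
    ∃ W' : Set V, W'.ncard = k ∧ ContractibleSet G W' := by
  obtain ⟨n, hn3, ⟨φ⟩⟩ := hcyc
  obtain ⟨p, hp⟩ := exists_isCycleParam hn3 φ
  have hn : 0 < n := by omega
  have hcompl : ∀ Y : Set V, Y.ncard + (Yᶜ).ncard = Fintype.card V := fun Y => by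
    rw [Set.ncard_add_ncard_compl, Nat.card_eq_fintype_card]
  have hn4 : 4 ≤ n := by
    have := hcompl W
    rw [hp.ncard_eq hn] at this
    omega
  have hmiss : ∀ v ∈ Wᶜ, {u ∈ W | ¬ G.Adj v u}.ncard ≤ c + 1 := fun v hv => by
    have := ncard_not_adj_le hδ (hp.ncard_adj_le hn hv)
    omega
  obtain ⟨w, hwW, hw⟩ := hp.exists_two_mul_card_lt hn hmiss (by omega)
  obtain ⟨K, hK_self, hK_sub, hK_eq, hK_conn, hK_adj⟩ := exists_components G (W \ {w})
  have hRcard : (W \ {w}).ncard + 1 = k - 1 := by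
    rw [Set.ncard_sdiff_singleton_add_one hwW, hWcard]
  -- `L` is the union of the small components of `W \ {w}`.
  let L : Set V := {z ∈ W \ {w} | (K z).ncard ≤ c + 1}
  have hLdeg : ∀ z ∈ L, c + 4 ≤ {u ∈ Wᶜ | G.Adj z u}.ncard := fun z hz => by
    have := le_ncard_adj_compl hδ (hK_self z hz.1) (hK_adj z z (hK_self z hz.1))
    have := hz.2
    omega
  obtain ⟨l, hl⟩ : ∃ l, l = min L.ncard c + 2 := ⟨_, rfl⟩
  have hln : l + 2 ≤ n := by
    rcases L.eq_empty_or_nonempty with hL | ⟨z, hz⟩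
    · rw [hL, Set.ncard_empty] at hl
      omega
    · have h1 := hLdeg z hz
      have h2 : {u ∈ Wᶜ | G.Adj z u}.ncard ≤ (Wᶜ).ncard := Set.ncard_le_ncard fun u hu => hu.1
      rw [hp.ncard_eq hn] at h2
      omega
  obtain ⟨i, hi0, hi1⟩ := hp.exists_adj_adj hw (l + 1)
  obtain ⟨q, hqdef⟩ : ∃ q : ℕ → V, q = fun j => p (i + j) := ⟨_, rfl⟩
  have hq : IsCycleParam G Wᶜ n q := hqdef ▸ hp.shift hn i
  have hw0 : G.Adj w (q 0) := by simpa [hqdef] using hi0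
  have hw1 : G.Adj w (q (l + 1)) := by simpa [hqdef] using hi1
  obtain ⟨I, hI⟩ : ∃ I, I = q '' Set.Icc 1 l := ⟨_, rfl⟩
  have hIW : I ⊆ Wᶜ := by
    rw [hI]
    exact Set.image_subset_iff.2 fun j _ => hq.mem j
  have hIcard : I.ncard = l := by
    rw [hI, hq.ncard_image_Icc (by omega)]
    omega
  have hIconn : (G.induce I).Connected := hI ▸ connected_induce_image_Icc hq.adj_succ (by omega)
  -- `U` is the union of the components of `W \ {w}` without neighbours in the arc `I`.
  let U : Set V := {z ∈ W \ {w} | ∀ y ∈ K z, ∀ x ∈ I, ¬ G.Adj y x}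
  have hUmiss : ∀ x ∈ I, U ⊆ {u ∈ W | ¬ G.Adj x u} := fun x hx z hz =>
    ⟨hz.1.1, fun h => hz.2 z (hK_self z hz.1) x hx h.symm⟩
  have hq1 : q 1 ∈ I := hI ▸ ⟨1, ⟨le_rfl, by omega⟩, rfl⟩
  have hUcard : U.ncard ≤ c + 1 :=
    (Set.ncard_le_ncard (hUmiss _ hq1)).trans (hmiss _ (hIW hq1))
  have hKU : ∀ z ∈ U, K z ⊆ U := fun z hz y hy => ⟨hK_sub z hy, by
    rw [hK_eq z y hy]
    exact hz.2⟩
  have hUL : U ⊆ L := fun z hz => ⟨hz.1, (Set.ncard_le_ncard (hKU z hz)).trans hUcard⟩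
  have hdisj : ∀ N ⊆ W \ {w}, (I ∪ (W \ {w}) \ N).ncard + N.ncard = l + (k - 2) := by
    intro N hN
    rw [Set.ncard_union_eq, hIcard]
    · have := Set.ncard_sdiff_add_ncard_of_subset hN
      omega
    · rw [Set.disjoint_left]
      exact fun x hx hx' => hIW hx hx'.1.1
  have hB : (G.induce (I ∪ (W \ {w}) \ U)).Connected := by
    refine connected_induce_union_pieces (K := K) hIconn fun z hz => ?_
    refine ⟨hK_self z hz.1, fun y hy => ⟨hK_sub z hy, fun hyU => hz.2 ?_⟩, hK_conn z hz.1, ?_⟩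
    · have : z ∈ K y := by
        rw [hK_eq z y hy]
        exact hK_self z hz.1
      exact hKU y hyU this
    · by_contra! hcon
      exact hz.2 ⟨hz.1, hcon⟩
  rcases Nat.lt_or_ge U.ncard (l - 1) with hUl | hUl
  · have hA : (G.induce (I ∪ (W \ {w}) \ L)).Connected := by
      refine connected_induce_union_pieces (K := K) hIconn fun z hz => ?_
      have hzc : c + 1 < (K z).ncard := by
        by_contra! hcon
        exact hz.2 ⟨hz.1, hcon⟩
      refine ⟨hK_self z hz.1, fun y hy => ⟨hK_sub z hy, fun hyL => ?_⟩, hK_conn z hz.1, ?_⟩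
      · have := hyL.2
        rw [hK_eq z y hy] at this
        omega
      · by_contra! hcon
        have hsub : K z ⊆ {u ∈ W | ¬ G.Adj (q 1) u} := fun y hy =>
          ⟨(hK_sub z hy).1, fun h => hcon y hy _ hq1 h.symm⟩
        have := (Set.ncard_le_ncard hsub).trans (hmiss _ (hIW hq1))
        omega
    have hAcard := hdisj L fun z hz => hz.1
    have hBcard := hdisj U fun z hz => hz.1
    obtain ⟨Y, hAY, hYB, hYk, hY⟩ := exists_connected_between (m := k) hA hB
      (Set.union_subset_union_right _ (Set.sdiff_subset_sdiff_right hUL)) (by omega) (by omega)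
    have hwY : w ∉ Y := fun h => by
      rcases hYB h with h | h
      · exact hIW h hwW
      · exact h.1.2 rfl
    refine ⟨Y, hYk, hq.contractibleSet (m := l) (T := {w}) (by omega) (by omega) ?_ ?_ ?_ hY
      (Set.singleton_subset_iff.2 ⟨hwW, hwY⟩) (connected_induce_singleton w)
      ⟨w, rfl, hw0.symm⟩ ⟨w, rfl, hw1.symm⟩ ?_ ?_⟩
    · rw [← hI]
      exact Set.subset_union_left.trans hAY
    · rw [← hI]
      exact hYB.trans (Set.union_subset_union_right _ fun z hz => hz.1.1)
    · have := hcompl Y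
      omega
    · rintro _ rfl
      refine (Set.ncard_pos (Set.toFinite _)).2 ⟨q (l + 1), ⟨hq.mem _, ?_⟩, hw1⟩
      rintro ⟨j, hj, hjl⟩
      have := hq.injOn_Icc (a := 1) (b := l + 1) (by omega) ⟨hj.1, hj.2.trans (Nat.le_succ l)⟩
        ⟨by omega, le_rfl⟩ hjl
      have := hj.2
      omega
    · rintro z ⟨hzW, hzY⟩ hzw
      have hzL : z ∈ L := by
        by_contra hzL
        exact hzY (hAY (Or.inr ⟨⟨hzW, hzw⟩, hzL⟩))
      have h1 := hLdeg z hzL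
      have h2 : {u ∈ Wᶜ | G.Adj z u} ⊆ {u ∈ Wᶜ \ I | G.Adj z u} ∪ I := fun u hu => by
        by_cases huI : u ∈ I
        · exact Or.inr huI
        · exact Or.inl ⟨⟨hu.1, huI⟩, hu.2⟩
      have h3 := (Set.ncard_le_ncard h2).trans (Set.ncard_union_le _ _)
      rw [← hI]
      omega
  · have hULcard := Set.ncard_le_ncard hUL
    have hlc : l = c + 2 := by omega
    have hUc : U.ncard = c + 1 := by omega
    have hUne : U.Nonempty := (Set.ncard_pos (Set.toFinite _)).1 (by omega)
    have hwU : w ∉ U := fun h => h.1.2 rfl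
    have hTcard : (insert w U).ncard = c + 2 := by
      rw [Set.ncard_insert_of_notMem hwU, hUc]
    have hUarc : ∀ z ∈ U, c + 4 ≤ {u ∈ Wᶜ \ I | G.Adj z u}.ncard := fun z hz =>
      (hLdeg z (hUL hz)).trans (Set.ncard_le_ncard fun u hu =>
        ⟨⟨hu.1, fun huI => hz.2 z (hK_self z hz.1) u huI hu.2⟩, hu.2⟩)
    have hln' : l + 4 ≤ n := by
      obtain ⟨z, hz⟩ := hUne
      have h1 := hUarc z hz
      have h2 : {u ∈ Wᶜ \ I | G.Adj z u}.ncard ≤ (Wᶜ \ I).ncard :=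
        Set.ncard_le_ncard fun u hu => hu.1
      have h3 := Set.ncard_sdiff_add_ncard_of_subset hIW
      rw [hp.ncard_eq hn] at h3
      omega
    have hT : (G.induce ({w} ∪ U)).Connected := by
      refine connected_induce_union_pieces (K := K) (connected_induce_singleton w) fun z hz => ?_
      refine ⟨hK_self z hz.1, hKU z hz, hK_conn z hz.1, ?_⟩
      by_contra! hcon
      have := (connected_induce_iff_closed.1 hWc.1).2 (K z) (fun y hy => (hK_sub z hy).1)
        ⟨z, hK_self z hz.1⟩ (fun x hx y hy hxy => hK_adj z x hx y ⟨hy, fun hyw =>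
          hcon x hx w rfl (hyw ▸ hxy)⟩ hxy) hwW
      exact (hK_sub z this).2 rfl
    have hI' : q '' Set.Icc 1 (l + 1) = insert (q (l + 1)) I := by
      rw [hI, ← Set.image_insert_eq]
      congr 1
      ext t
      simp only [Set.mem_insert_iff, Set.mem_Icc]
      omega
    have hY : (G.induce (insert (q (l + 1)) (I ∪ (W \ {w}) \ U))).Connected := by
      refine connected_induce_of_attach hB (Set.subset_insert _ _) fun b hb hbY => ?_
      obtain rfl : b = q (l + 1) := hb.resolve_right hbY
      exact ⟨q l, Or.inl (hI ▸ ⟨l, ⟨by omega, le_rfl⟩, rfl⟩), (hq.adj_succ l).symm⟩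
    have hYcard : (insert (q (l + 1)) (I ∪ (W \ {w}) \ U)).ncard = k := by
      have h1 := hdisj U fun z hz => hz.1
      rw [Set.ncard_insert_of_notMem]
      · omega
      · rintro (h | h)
        · rw [hI] at h
          obtain ⟨j, hj, hjl⟩ := h
          have := hq.injOn_Icc (a := 1) (b := l + 1) (by omega)
            ⟨hj.1, hj.2.trans (Nat.le_succ l)⟩ ⟨by omega, le_rfl⟩ hjl
          have := hj.2
          omega
        · exact hq.mem (l + 1) h.1.1
    have hsub : W \ insert (q (l + 1)) (I ∪ (W \ {w}) \ U) = {w} ∪ U := by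
      ext z
      have h1 : z ∈ I → z ∉ W := fun h => hIW h
      have h2 : z = q (l + 1) → z ∉ W := fun h => h ▸ hq.mem (l + 1)
      have h3 : z ∈ U → z ∈ W := fun h => h.1.1
      have h4 : z = w → z ∈ W := fun h => h ▸ hwW
      simp only [Set.mem_sdiff, Set.mem_insert_iff, Set.mem_union, Set.mem_singleton_iff]
      tauto
    refine ⟨_, hYcard, hq.contractibleSet (m := l + 1) (T := {w} ∪ U) (by omega) (by omega) ?_ ?_
      ?_ hY hsub.ge hT ⟨w, Or.inl rfl, hw0.symm⟩ ?_ ?_ ?_⟩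
    · rw [hI']
      exact Set.insert_subset_insert Set.subset_union_left
    · rw [hI']
      exact Set.insert_subset (Or.inl (Set.mem_insert _ _)) (Set.union_subset_union
        (Set.subset_insert _ _) fun z hz => hz.1.1)
    · have := hcompl (insert (q (l + 1)) (I ∪ (W \ {w}) \ U))
      omega
    · by_contra! hcon
      have h1 : {w} ∪ U ⊆ {u ∈ W | ¬ G.Adj (q (l + 1 + 1)) u} := fun u hu =>
        ⟨(hsub.ge hu).1, hcon u hu⟩
      have h2 := (Set.ncard_le_ncard h1).trans (hmiss _ (hq.mem _))
      rw [Set.singleton_union, hTcard] at h2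
      omega
    · rintro z (rfl | hz)
      · refine (Set.ncard_pos (Set.toFinite _)).2 ⟨q 0, ⟨hq.mem _, ?_⟩, hw0⟩
        rintro ⟨j, hj, hj0⟩
        have := hq.injOn_Icc (a := 0) (b := l + 1) (by omega) ⟨by omega, hj.2⟩
          ⟨le_rfl, by omega⟩ hj0
        have := hj.1
        omega
      · have h1 := hUarc z hz
        have h2 : {u ∈ Wᶜ \ I | G.Adj z u} ⊆
            insert (q (l + 1)) {u ∈ Wᶜ \ q '' Set.Icc 1 (l + 1) | G.Adj z u} := fun u hu => by
          rw [hI']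
          by_cases hul : u = q (l + 1)
          · exact Or.inl hul
          · exact Or.inr ⟨⟨hu.1.1, fun h => h.elim hul hu.1.2⟩, hu.2⟩
        have h3 := (Set.ncard_le_ncard h2).trans (Set.ncard_insert_le _ _)
        omega
    · intro z hz hzT
      rw [hsub] at hz
      exact absurd hz hzT
end

section
/- Let G be a finite connected simple graph and let F ⊆ V(G) be a set of vertices ("forbidden" vertices) with F ≠ V(G). Then the set of vertices x ∈ V(G) such that some connected component of G − x has all of its vertices in F has cardinality at most |F|. -/
open SimpleGraph

namespace SimpleGraph

variable {V : Type*} {G : SimpleGraph V} {x : V} {S : Set V}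

/-- The vertex set of a component of `G − x`, seen in `G`, can only be left through `x`. -/
theorem ConnectedComponent.exists_set_of_compl_singleton
    (C : (G.induce (({x}ᶜ : Set V))).ConnectedComponent) :
    ∃ S : Set V, S = (↑) '' C.supp ∧ S.Nonempty ∧ x ∉ S ∧
      ∀ u ∈ S, ∀ w, G.Adj u w → w ≠ x → w ∈ S := by
  refine ⟨_, rfl, C.nonempty_supp.image _, ?_, ?_⟩
  · rintro ⟨v, -, hv⟩
    exact v.2 hv
  · rintro _ ⟨u, hu, rfl⟩ w huw hwx
    refine ⟨⟨w, hwx⟩, ?_, rfl⟩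
    exact C.mem_supp_of_adj_mem_supp hu (by simpa using huw)

theorem Walk.exists_adj_mem_support_of_closed {v r : V} (p : G.Walk v r)
    (hS : ∀ u ∈ S, ∀ w, G.Adj u w → w ≠ x → w ∈ S) (hv : v ∈ S) (hr : r ∉ S) :
    x ∈ p.support ∧ ∃ y ∈ S, G.Adj x y := by
  obtain ⟨d, hd, hfst, hsnd⟩ := p.exists_boundary_dart S hv hr
  have hdx : d.snd = x := by
    by_contra h
    exact hsnd (hS _ hfst _ d.adj h)
  exact ⟨hdx ▸ p.dart_snd_mem_support_of_mem_darts hd, d.fst, hfst, hdx ▸ d.adj.symm⟩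

theorem Connected.dist_lt_of_closed (hG : G.Connected) {v r : V}
    (hS : ∀ u ∈ S, ∀ w, G.Adj u w → w ≠ x → w ∈ S) (hx : x ∉ S) (hv : v ∈ S) (hr : r ∉ S) :
    G.dist x r < G.dist v r := by
  classical
  obtain ⟨p, hp⟩ := hG.exists_walk_length_eq_dist v r
  have hxp := (p.exists_adj_mem_support_of_closed hS hv hr).1
  have hlen := congrArg Walk.length (p.take_spec hxp)
  rw [Walk.length_append] at hlen
  have hpos : 0 < (p.takeUntil x hxp).length := by
    rw [Nat.pos_iff_ne_zero]
    intro h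
    exact hx (Walk.eq_of_length_eq_zero h ▸ hv)
  have := dist_le (p.dropUntil x hxp)
  omega

end SimpleGraph

/-- In a finite connected graph `G` with a set `F ⊊ V(G)` of forbidden vertices, the
number of vertices `x` such that some connected component of `G − x` lies entirely in
`F` is at most `|F|`. -/
theorem stmt_5 {V : Type*} [Fintype V] (G : SimpleGraph V) (hG : G.Connected)
    (F : Set V) (hF : F ≠ Set.univ) :
    {x : V | ∃ C : (G.induce (({x}ᶜ : Set V))).ConnectedComponent,
        ∀ v, v ∈ C.supp → (v : V) ∈ F}.ncard ≤ F.ncard := by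
  classical
  obtain ⟨r, hr⟩ := (Set.ne_univ_iff_exists_notMem F).1 hF
  have key : ∀ x ∈ {x : V | ∃ C : (G.induce (({x}ᶜ : Set V))).ConnectedComponent,
      ∀ v, v ∈ C.supp → (v : V) ∈ F}, ∃ y ∈ F, G.Adj x y ∧
        ∀ w, G.Adj y w → w ≠ x → G.dist x r < G.dist w r := by
    rintro x ⟨C, hC⟩
    obtain ⟨S, rfl, ⟨v, hv⟩, hx, hS⟩ := C.exists_set_of_compl_singleton
    have hSF : (↑) '' C.supp ⊆ F := by
      rintro _ ⟨u, hu, rfl⟩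
      exact hC u hu
    obtain ⟨p⟩ := hG.preconnected v x
    obtain ⟨-, y, hy, hxy⟩ := p.exists_adj_mem_support_of_closed hS hv hx
    exact ⟨y, hSF hy, hxy, fun w hyw hwx =>
      hG.dist_lt_of_closed hS hx (hS y hy w hyw hwx) fun h => hr (hSF h)⟩
  choose! f hfF hadj hdist using key
  refine Set.ncard_le_ncard_of_injOn f hfF ?_ F.toFinite
  intro a ha b hb hab
  by_contra hne
  have h₁ := hdist a ha b (hab ▸ (hadj b hb).symm) (Ne.symm hne)
  have h₂ := hdist b hb a (hab ▸ (hadj a ha).symm) hne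
  exact lt_asymm h₁ h₂
end
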